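/- arXiv:2012.10691 — 5 statements merged into one kernel-verified Lean document; each statement's English description precedes it below -/
import Mathlib

section
/- Let A be a closed set in a real Hilbert space H and let R > 0. The following conditions are equivalent: (1) A is proximally smooth with constant R; (2) for any two distinct points x0, x1 ∈ A with ‖x0 − x1‖ < 2R there exists a curve contained in A with endpoints x0 and x1 whose length is at most 2R·arcsin(‖x0 − x1‖/(2R)). -/
noncomputable section

open Set Metric

/-- The modulus of smoothness of a normed space `X`. -/
def modSmooth (X : Type*) [NormedAddCommGroup X] [NormedSpace ℝ X] (τ : ℝ) : ℝ :=
  sSup {r : ℝ | ∃ x y : X, ‖x‖ = 1 ∧ ‖y‖ = τ ∧ r = (‖x + y‖ + ‖x - y‖) / 2 - 1}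

/-- `X` is uniformly smooth: `ρ_X(τ)/τ → 0` as `τ → 0⁺`. -/
def UnifSmooth (X : Type*) [NormedAddCommGroup X] [NormedSpace ℝ X] : Prop :=
  Filter.Tendsto (fun τ => modSmooth X τ / τ) (nhdsWithin 0 (Set.Ioi 0)) (nhds 0)

/-- The modulus of convexity of a normed space `X`. -/
def modConvex (X : Type*) [NormedAddCommGroup X] [NormedSpace ℝ X] (ε : ℝ) : ℝ :=
  sInf {r : ℝ | ∃ x y : X, ‖x‖ ≤ 1 ∧ ‖y‖ ≤ 1 ∧ ε ≤ ‖x - y‖ ∧ r = 1 - ‖x + y‖ / 2}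

/-- A closed set `A` is proximally smooth with constant `R` if the distance function
is continuously (Fréchet) differentiable on the open `R`-neighborhood of `A`. -/
def ProximallySmooth {X : Type*} [NormedAddCommGroup X] [NormedSpace ℝ X]
    (A : Set X) (R : ℝ) : Prop :=
  IsClosed A ∧ ContDiffOn ℝ 1 (fun x => Metric.infDist x A)
    {x : X | 0 < Metric.infDist x A ∧ Metric.infDist x A < R}

/-- `y` is quasi-orthogonal to `x`: `‖x + λ y‖ ≥ ‖x‖` for all real `λ`
(Birkhoff--James orthogonality of `x` to `y`). -/
def QuasiOrth {X : Type*} [NormedAddCommGroup X] [NormedSpace ℝ X] (y x : X) : Prop :=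
  ∀ l : ℝ, ‖x‖ ≤ ‖x + l • y‖

/-- `ζ_X^+(ε) = sup{‖x + ε y‖ : ‖x‖ = ‖y‖ = 1, y ⌐ x}`. -/
def zetaPlus (X : Type*) [NormedAddCommGroup X] [NormedSpace ℝ X] (ε : ℝ) : ℝ :=
  sSup {r : ℝ | ∃ x y : X, ‖x‖ = 1 ∧ ‖y‖ = 1 ∧ QuasiOrth y x ∧ r = ‖x + ε • y‖}

/-- `ω_X(τ) = ρ_X(τ)/τ`. -/
def omegaX (X : Type*) [NormedAddCommGroup X] [NormedSpace ℝ X] (τ : ℝ) : ℝ :=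
  modSmooth X τ / τ

/-- The inverse function of `ω_X`. -/
def omegaInv (X : Type*) [NormedAddCommGroup X] [NormedSpace ℝ X] : ℝ → ℝ :=
  Function.invFun (omegaX X)

/-- The inverse function of `ζ_X^+`. -/
def zetaPlusInv (X : Type*) [NormedAddCommGroup X] [NormedSpace ℝ X] : ℝ → ℝ :=
  Function.invFun (zetaPlus X)

/-- `R′(τ, R) = 8R·ρ_X(τ/R)/(1 − 8 ω_X(τ/R))`. -/
def Rprime (X : Type*) [NormedAddCommGroup X] [NormedSpace ℝ X] (τ R : ℝ) : ℝ :=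
  8 * R * modSmooth X (τ / R) / (1 - 8 * omegaX X (τ / R))

/-- The metric projection of `x` onto `A`. -/
def metricProj {X : Type*} [NormedAddCommGroup X] [NormedSpace ℝ X]
    (A : Set X) (x : X) : Set X :=
  {a : X | a ∈ A ∧ ‖a - x‖ = Metric.infDist x A}

/-- The metric projection of the segment `[x0, x1]` onto `A`. -/
def metricProjSeg {X : Type*} [NormedAddCommGroup X] [NormedSpace ℝ X]
    (A : Set X) (x0 x1 : X) : Set X :=
  ⋃ x ∈ segment ℝ x0 x1, metricProj A x

/-- A slice-projection of the midpoint of `[x0, x1]` onto `A`. -/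
def IsSliceProj {X : Type*} [NormedAddCommGroup X] [NormedSpace ℝ X]
    (A : Set X) (x0 x1 z : X) : Prop :=
  z ∈ metricProjSeg A x0 x1 ∧ QuasiOrth (z - midpoint ℝ x0 x1) (x0 - x1)

/-- `f` parametrizes a curve in `A` with endpoints `x0` and `x1`. -/
def IsCurveIn {X : Type*} [NormedAddCommGroup X] [NormedSpace ℝ X]
    (A : Set X) (x0 x1 : X) (f : ℝ → X) : Prop :=
  ContinuousOn f (Set.Icc 0 1) ∧ f 0 = x0 ∧ f 1 = x1 ∧ f '' Set.Icc 0 1 ⊆ A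

open InnerProductGeometry in
lemma aux_chord_lower {H : Type*} [NormedAddCommGroup H] [InnerProductSpace ℝ H]
    (u v : H) (r : ℝ) (hr : 0 < r) (hu : r ≤ ‖u‖) (hv : r ≤ ‖v‖) :
    2 * r * Real.sin (angle u v / 2) ≤ ‖u - v‖ := by
  have h := norm_sub_sq_eq_norm_sq_add_norm_sq_sub_two_mul_norm_mul_norm_mul_cos_angle u v
  have hc : Real.cos (angle u v) = 1 - 2 * Real.sin (angle u v / 2) ^ 2 := by
    have h1 := Real.cos_two_mul (angle u v / 2)
    have h2 := Real.sin_sq_add_cos_sq (angle u v / 2)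
    rw [show 2 * (angle u v / 2) = angle u v by ring] at h1
    linarith
  refine (le_abs_self _).trans (abs_le_of_sq_le_sq ?_ (norm_nonneg _))
  rw [hc] at h
  have h3 : r * r ≤ ‖u‖ * ‖v‖ := mul_le_mul hu hv hr.le (norm_nonneg _)
  have h4 := mul_le_mul_of_nonneg_right h3 (sq_nonneg (Real.sin (angle u v / 2)))
  nlinarith [sq_nonneg (‖u‖ - ‖v‖)]

open InnerProductGeometry in
lemma aux_chord_upper {H : Type*} [NormedAddCommGroup H] [InnerProductSpace ℝ H]
    (u v : H) (r ρ : ℝ) (hr : 0 < r) (hu : r ≤ ‖u‖) (hv : r ≤ ‖v‖)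
    (hu' : ‖u‖ ≤ ρ) (hv' : ‖v‖ ≤ ρ) :
    ‖u - v‖ ≤ (ρ - r) + 2 * ρ * Real.sin (angle u v / 2) := by
  have h := norm_sub_sq_eq_norm_sq_add_norm_sq_sub_two_mul_norm_mul_norm_mul_cos_angle u v
  have hc : Real.cos (angle u v) = 1 - 2 * Real.sin (angle u v / 2) ^ 2 := by
    have h1 := Real.cos_two_mul (angle u v / 2)
    have h2 := Real.sin_sq_add_cos_sq (angle u v / 2)
    rw [show 2 * (angle u v / 2) = angle u v by ring] at h1
    linarith
  have hs : 0 ≤ Real.sin (angle u v / 2) := by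
    apply Real.sin_nonneg_of_nonneg_of_le_pi
    · linarith [angle_nonneg u v]
    · linarith [angle_le_pi u v, Real.pi_pos]
  rw [hc] at h
  have hp : 0 ≤ ρ - r := by linarith
  have hp' : 0 ≤ ρ := by linarith
  refine (le_abs_self _).trans (abs_le_of_sq_le_sq ?_ (by positivity))
  have h3 : ‖u‖ * ‖v‖ ≤ ρ * ρ := mul_le_mul hu' hv' (norm_nonneg _) hp'
  have h4 := mul_le_mul_of_nonneg_right h3 (sq_nonneg (Real.sin (angle u v / 2)))
  have h5 : (‖u‖ - ‖v‖) ^ 2 ≤ (ρ - r) ^ 2 := by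
    apply sq_le_sq'  <;> linarith
  nlinarith [mul_nonneg (mul_nonneg hp hp') hs]

open InnerProductGeometry in
lemma aux_angle_sum {H : Type*} [NormedAddCommGroup H] [InnerProductSpace ℝ H]
    (g : ℕ → H) (n : ℕ) (h0 : g 0 ≠ 0) :
    angle (g 0) (g n) ≤ ∑ i ∈ Finset.range n, angle (g i) (g (i + 1)) := by
  induction n with
  | zero => simp [angle_self h0]
  | succ n ih =>
    rw [Finset.sum_range_succ]
    exact (angle_le_angle_add_angle _ (g n) _).trans (by linarith)

open InnerProductGeometry in
lemma aux_length {H : Type*} [NormedAddCommGroup H] [InnerProductSpace ℝ H]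
    (f : ℝ → H) (x : H) (r : ℝ) (hr : 0 < r) (hf : ContinuousOn f (Set.Icc 0 1))
    (hx : ∀ t ∈ Set.Icc (0:ℝ) 1, r ≤ ‖f t - x‖) (L : ℝ) (hL : 0 ≤ L)
    (hv : eVariationOn f (Set.Icc 0 1) ≤ ENNReal.ofReal L) :
    r * angle (f 0 - x) (f 1 - x) ≤ L := by
  -- enough: (1 - ε) r θ ≤ L
  have key : ∀ ε : ℝ, 0 < ε → ε < 1 → (1 - ε) * (r * angle (f 0 - x) (f 1 - x)) ≤ L := by
    intro ε hε hε1
    have huc : UniformContinuousOn f (Set.Icc 0 1) :=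
      isCompact_Icc.uniformContinuousOn_of_continuous hf
    rw [Metric.uniformContinuousOn_iff] at huc
    obtain ⟨δ, hδ, hδ'⟩ := huc (2 * r * ε / Real.pi) (by positivity)
    obtain ⟨N, hN⟩ := exists_nat_gt (1 / δ)
    have hN0 : (0:ℝ) < N := lt_trans (by positivity) hN
    have hNδ : 1 / (N:ℝ) < δ := by
      rw [div_lt_iff₀ hN0]; rw [div_lt_iff₀ hδ] at hN; linarith
    set u : ℕ → ℝ := fun i => (i:ℝ) / N with hu
    have hmem : ∀ i ≤ N, u i ∈ Set.Icc (0:ℝ) 1 := by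
      intro i hi
      refine ⟨by positivity, ?_⟩
      rw [hu]; simp only
      rw [div_le_one hN0]; exact_mod_cast hi
    have hmono : MonotoneOn u (Set.Iic N) := by
      intro i _ j _ hij
      simp only [hu]
      gcongr
    have hsum := (eVariationOn.sum_le_of_monotoneOn_Iic (f := f) hmono hmem).trans hv
    simp only [edist_dist] at hsum
    rw [← ENNReal.ofReal_sum_of_nonneg (fun _ _ => dist_nonneg),
      ENNReal.ofReal_le_ofReal_iff hL] at hsum
    refine le_trans ?_ hsum
    set g : ℕ → H := fun i => f (u i) - x with hg
    have hgn : ∀ i ≤ N, r ≤ ‖g i‖ := fun i hi => hx _ (hmem i hi)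
    have hg0 : g 0 = f 0 - x := by simp [hg, hu]
    have hgN : g N = f 1 - x := by
      have : u N = 1 := by simp only [hu]; exact div_self hN0.ne'
      simp only [hg, this]
    have hne : g 0 ≠ 0 := by
      intro h
      have := hgn 0 (Nat.zero_le _)
      rw [h, norm_zero] at this; linarith
    have hang := aux_angle_sum g N hne
    rw [hg0, hgN] at hang
    calc (1 - ε) * (r * angle (f 0 - x) (f 1 - x))
        ≤ (1 - ε) * (r * ∑ i ∈ Finset.range N, angle (g i) (g (i + 1))) := by
          have : 0 ≤ 1 - ε := by linarith
          gcongr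
      _ = ∑ i ∈ Finset.range N, (1 - ε) * (r * angle (g i) (g (i + 1))) := by
          rw [Finset.mul_sum, Finset.mul_sum]
      _ ≤ _ := by
          apply Finset.sum_le_sum
          intro i hi
          have hi' := Finset.mem_range.1 hi
          have hd : dist (f (u (i+1))) (f (u i)) = ‖g i - g (i+1)‖ := by
            rw [dist_comm, dist_eq_norm]; simp only [hg]; congr 1; abel
          have hlt : dist (f (u (i+1))) (f (u i)) < 2 * r * ε / Real.pi := by
            apply hδ' _ (hmem _ (by omega)) _ (hmem _ (by omega))
            rw [Real.dist_eq]
            have : u (i+1) - u i = 1 / N := by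
              simp only [hu]; push_cast; ring
            rw [this, abs_of_nonneg (by positivity)]; exact hNδ
          have hlow := aux_chord_lower (g i) (g (i+1)) r hr (hgn _ (by omega)) (hgn _ (by omega))
          rw [hd] at hlt ⊢
          set θ := angle (g i) (g (i+1))
          have hθ0 : 0 ≤ θ := angle_nonneg _ _
          have hθpi : θ ≤ Real.pi := angle_le_pi _ _
          have h1 := Real.mul_le_sin (x := θ / 2) (by linarith) (by linarith)
          have h2 := Real.sin_ge_sub_cube (x := θ / 2) (by linarith)
          have h3 : 2 / Real.pi * (θ / 2) < ε / Real.pi := by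
            have : 2 * r * (2 / Real.pi * (θ / 2)) < 2 * r * (ε / Real.pi) := by
              calc _ ≤ 2 * r * Real.sin (θ / 2) := by gcongr
                _ ≤ _ := hlow
                _ < _ := hlt
                _ = _ := by ring
            exact lt_of_mul_lt_mul_left this (by positivity)
          have h4 : θ < ε := by
            have hpi := Real.pi_pos
            rw [show 2 / Real.pi * (θ / 2) = θ / Real.pi by ring] at h3
            exact (div_lt_div_iff_of_pos_right hpi).1 h3
          refine le_trans ?_ hlow
          have h5 : (1 - ε) * (θ / 2) ≤ Real.sin (θ / 2) := by
            refine le_trans ?_ h2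
            have : (θ/2)^3/6 ≤ ε * (θ/2) := by
              have : θ ^ 2 ≤ ε := by nlinarith
              nlinarith
            linarith
          nlinarith
  by_contra hcon
  push Not at hcon
  set M := r * angle (f 0 - x) (f 1 - x)
  have hM : 0 < M := by linarith
  have := key ((M - L) / (2 * M)) (by apply div_pos <;> linarith)
    (by rw [div_lt_one (by linarith)]; linarith)
  have h2 : (1 - (M - L) / (2 * M)) * M = (M + L) / 2 := by field_simp; ring
  linarith

lemma aux_sin_gap (r R : ℝ) (hr : 0 < r) (hrR : r < R) (δ : ℝ) (hδ : 0 < δ) :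
    ∃ ε > 0, ∀ τ ∈ Set.Icc (0:ℝ) (Real.pi / 2),
      2 * R * Real.sin (r * τ / R) - 2 * r * Real.sin τ ≤ ε → τ < δ := by
  have hR : 0 < R := hr.trans hrR
  by_cases hne : (Set.Icc δ (Real.pi / 2)).Nonempty
  · obtain ⟨τ₀, hτ₀, hmin⟩ := (isCompact_Icc (a := δ) (b := Real.pi / 2)).exists_isMinOn hne
      (f := fun τ => 2 * R * Real.sin (r * τ / R) - 2 * r * Real.sin τ) (by fun_prop)
    have hpos : 0 < 2 * R * Real.sin (r * τ₀ / R) - 2 * r * Real.sin τ₀ := by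
      have hτpos : 0 < τ₀ := hδ.trans_le hτ₀.1
      have h := strictConcaveOn_sin_Icc.2 (show (0:ℝ) ∈ Set.Icc 0 Real.pi from ⟨le_rfl, Real.pi_pos.le⟩)
        (show τ₀ ∈ Set.Icc 0 Real.pi from ⟨hτpos.le, by linarith [hτ₀.2, Real.pi_pos]⟩) hτpos.ne
        (show 0 < 1 - r / R by rw [sub_pos, div_lt_one hR]; exact hrR)
        (show 0 < r / R by positivity) (by ring)
      simp only [smul_eq_mul, Real.sin_zero, mul_zero, zero_add] at h
      rw [show r / R * τ₀ = r * τ₀ / R by ring] at h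
      have h2 : 2 * R * (r / R * Real.sin τ₀) < 2 * R * Real.sin (r * τ₀ / R) := by gcongr
      have h3 : 2 * R * (r / R * Real.sin τ₀) = 2 * r * Real.sin τ₀ := by field_simp
      linarith
    refine ⟨_, half_pos hpos, ?_⟩
    intro τ hτ hle
    by_contra hcon
    push Not at hcon
    have := hmin (show τ ∈ Set.Icc δ (Real.pi / 2) from ⟨hcon, hτ.2⟩)
    simp only [Set.mem_ofPred_eq] at this
    linarith
  · refine ⟨1, one_pos, ?_⟩
    intro τ hτ _
    by_contra hcon
    push Not at hcon
    exact hne ⟨τ, hcon, hτ.2⟩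

open InnerProductGeometry in
lemma aux_key {H : Type*} [NormedAddCommGroup H] [InnerProductSpace ℝ H]
    (A : Set H) (R : ℝ) (hR : 0 < R)
    (h2 : ∀ x0 ∈ A, ∀ x1 ∈ A, x0 ≠ x1 → ‖x0 - x1‖ < 2 * R →
        ∃ f : ℝ → H, IsCurveIn A x0 x1 f ∧
          eVariationOn f (Set.Icc 0 1) ≤
            ENNReal.ofReal (2 * R * Real.arcsin (‖x0 - x1‖ / (2 * R))))
    (x : H) (h0 : 0 < Metric.infDist x A) (h1 : Metric.infDist x A < R) (ε : ℝ) (hε : 0 < ε) :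
    ∃ η > 0, ∀ a ∈ A, ∀ b ∈ A, ‖a - x‖ ≤ Metric.infDist x A + η →
      ‖b - x‖ ≤ Metric.infDist x A + η → ‖a - b‖ < ε := by
  have hdist : ∀ y ∈ A, Metric.infDist x A ≤ ‖y - x‖ := by
    intro y hy
    rw [← dist_eq_norm, dist_comm]
    exact Metric.infDist_le_dist_of_mem hy
  set r := Metric.infDist x A with hr
  obtain ⟨e, he, hgap⟩ := aux_sin_gap r R h0 h1 (ε / (4 * R)) (by positivity)
  have hη0 : 0 < min (e / 3) (min (ε / 2) ((R - r) / 2)) :=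
    lt_min (by positivity) (lt_min (by positivity) (by linarith))
  refine ⟨min (e / 3) (min (ε / 2) ((R - r) / 2)), hη0, ?_⟩
  have hη1 : min (e / 3) (min (ε / 2) ((R - r) / 2)) ≤ e / 3 := min_le_left _ _
  have hη2 : min (e / 3) (min (ε / 2) ((R - r) / 2)) ≤ ε / 2 :=
    (min_le_right _ _).trans (min_le_left _ _)
  have hη3 : min (e / 3) (min (ε / 2) ((R - r) / 2)) ≤ (R - r) / 2 :=
    (min_le_right _ _).trans (min_le_right _ _)
  generalize min (e / 3) (min (ε / 2) ((R - r) / 2)) = η at *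
  intro a ha b hb hax hbx
  by_cases hab : a = b
  · simp [hab, hε]
  have hc : ‖a - b‖ < 2 * R := by
    have : a - b = (a - x) - (b - x) := by abel
    rw [this]
    linarith [norm_sub_le (a - x) (b - x)]
  obtain ⟨f, ⟨hfc, hf0, hf1, hfA⟩, hlen⟩ := h2 a ha b hb hab hc
  have hc1 : ‖a - b‖ / (2 * R) ≤ 1 := by rw [div_le_one (by positivity)]; exact hc.le
  have hc0 : 0 ≤ ‖a - b‖ / (2 * R) := by positivity
  have hlen' := aux_length f x r h0 hfc
    (fun t ht => hdist _ (hfA ⟨t, ht, rfl⟩)) _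
    (by have := Real.arcsin_nonneg.2 hc0; positivity) hlen
  rw [hf0, hf1] at hlen'
  have hup := aux_chord_upper (a - x) (b - x) r (r + η) h0 (hdist a ha) (hdist b hb) hax hbx
  rw [show a - x - (b - x) = a - b by abel] at hup
  obtain ⟨τ, hτ⟩ : ∃ τ, τ = angle (a - x) (b - x) / 2 := ⟨_, rfl⟩
  have hτ2 : angle (a - x) (b - x) = 2 * τ := by linarith
  rw [← hτ] at hup
  rw [hτ2] at hlen'
  have hτ0 : 0 ≤ τ := by linarith [angle_nonneg (a - x) (b - x)]
  have hτ1 : τ ≤ Real.pi / 2 := by linarith [angle_le_pi (a - x) (b - x)]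
  have hs0 : 0 ≤ r * τ / R := by positivity
  have hs1 : r * τ / R ≤ τ := by
    rw [div_le_iff₀ hR]; nlinarith
  have hs2 : r * τ / R ≤ Real.arcsin (‖a - b‖ / (2 * R)) := by
    rw [div_le_iff₀ hR]; linarith
  rw [Real.le_arcsin_iff_sin_le ⟨by linarith [Real.pi_pos], by linarith⟩ ⟨by linarith, hc1⟩,
    le_div_iff₀ (by positivity)] at hs2
  have hsin1 := Real.sin_le_one τ
  have hsinle := Real.sin_le hτ0
  have hη' : η * Real.sin τ ≤ η := by nlinarith
  have hτδ := hgap τ ⟨hτ0, hτ1⟩ (by nlinarith)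
  rw [lt_div_iff₀ (by positivity)] at hτδ
  have hsn : 0 ≤ Real.sin τ := Real.sin_nonneg_of_nonneg_of_le_pi hτ0 (by linarith [Real.pi_pos])
  nlinarith

lemma aux_contDiff {H : Type*} [NormedAddCommGroup H] [InnerProductSpace ℝ H]
    [CompleteSpace H] (A : Set H) (hA : IsClosed A) (R : ℝ)
    (hkey : ∀ x : H, 0 < Metric.infDist x A → Metric.infDist x A < R → ∀ ε > 0,
      ∃ η > 0, ∀ a ∈ A, ∀ b ∈ A, ‖a - x‖ ≤ Metric.infDist x A + η →
      ‖b - x‖ ≤ Metric.infDist x A + η → ‖a - b‖ < ε) :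
    ContDiffOn ℝ 1 (fun x => Metric.infDist x A)
      {x : H | 0 < Metric.infDist x A ∧ Metric.infDist x A < R} := by
  set U := {x : H | 0 < Metric.infDist x A ∧ Metric.infDist x A < R} with hU
  have hUo : IsOpen U :=
    (isOpen_lt continuous_const (Metric.continuous_infDist_pt A)).inter
      (isOpen_lt (Metric.continuous_infDist_pt A) continuous_const)
  -- nearest points
  have hex : ∀ x : H, ∃ a, x ∈ U → a ∈ A ∧ ‖a - x‖ = Metric.infDist x A := by
    intro x
    by_cases hx : x ∈ U
    swap
    · exact ⟨x, fun h => absurd h hx⟩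
    have hne : A.Nonempty := by
      by_contra h
      rw [Set.not_nonempty_iff_eq_empty] at h
      have := hx.1
      rw [h, Metric.infDist_empty] at this
      exact lt_irrefl _ this
    have hseq : ∀ n : ℕ, ∃ a ∈ A, dist x a < Metric.infDist x A + 1 / ((n:ℝ) + 1) := by
      intro n
      rw [← Metric.infDist_lt_iff hne]
      have : 0 < 1 / ((n:ℝ) + 1) := by positivity
      linarith
    choose a haA had using hseq
    have hcau : CauchySeq a := by
      rw [Metric.cauchySeq_iff]
      intro ε hε
      obtain ⟨η, hη, h⟩ := hkey x hx.1 hx.2 ε hε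
      obtain ⟨N, hN⟩ := exists_nat_one_div_lt hη
      have hb : ∀ n ≥ N, ‖a n - x‖ ≤ Metric.infDist x A + η := by
        intro n hn
        rw [← dist_eq_norm, dist_comm]
        have h1 := had n
        have h2 : 1 / ((n:ℝ) + 1) ≤ 1 / ((N:ℝ) + 1) := by
          have : (N:ℝ) ≤ n := by exact_mod_cast hn
          gcongr
        linarith
      refine ⟨N, fun m hm n hn => ?_⟩
      rw [dist_eq_norm]
      exact h _ (haA m) _ (haA n) (hb m hm) (hb n hn)
    obtain ⟨p, hp⟩ := cauchySeq_tendsto_of_complete hcau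
    have hpA : p ∈ A := hA.mem_of_tendsto hp (Filter.Eventually.of_forall haA)
    refine ⟨p, fun _ => ⟨hpA, ?_⟩⟩
    rw [← dist_eq_norm, dist_comm]
    apply le_antisymm
    · have ht1 : Filter.Tendsto (fun n => dist x (a n)) Filter.atTop (nhds (dist x p)) :=
        tendsto_const_nhds.dist hp
      have ht2 : Filter.Tendsto (fun n : ℕ => Metric.infDist x A + 1 / ((n:ℝ) + 1)) Filter.atTop
          (nhds (Metric.infDist x A + 0)) :=
        tendsto_const_nhds.add tendsto_one_div_add_atTop_nhds_zero_nat
      rw [add_zero] at ht2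
      exact le_of_tendsto_of_tendsto' ht1 ht2 (fun n => (had n).le)
    · exact Metric.infDist_le_dist_of_mem hpA
  choose P hP using hex
  have hcont : ∀ x ∈ U, ContinuousAt P x := by
    intro x hx
    rw [Metric.continuousAt_iff']
    intro ε hε
    obtain ⟨η, hη, h⟩ := hkey x hx.1 hx.2 ε hε
    filter_upwards [hUo.mem_nhds hx, Metric.ball_mem_nhds x (half_pos hη)] with y hy hyx
    rw [dist_eq_norm]
    apply h _ (hP y hy).1 _ (hP x hx).1
    · have h1 : ‖P y - x‖ ≤ ‖P y - y‖ + ‖y - x‖ := by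
        have : P y - x = (P y - y) + (y - x) := by abel
        rw [this]; exact norm_add_le _ _
      rw [(hP y hy).2] at h1
      have h2 := Metric.infDist_le_infDist_add_dist (s := A) (x := y) (y := x)
      rw [Metric.mem_ball, dist_eq_norm] at hyx
      rw [dist_eq_norm] at h2
      linarith
    · rw [(hP x hx).2]; linarith
  have hder : ∀ x ∈ U, HasFDerivAt (fun y => Metric.infDist y A ^ 2)
      (innerSL ℝ ((2:ℝ) • (x - P x))) x := by
    intro x hx
    rw [hasFDerivAt_iff_isLittleO, Asymptotics.isLittleO_iff]
    intro c hc
    have hcx := Metric.continuousAt_iff'.1 (hcont x hx) (c / 4) (by positivity)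
    filter_upwards [hUo.mem_nhds hx, hcx, Metric.ball_mem_nhds x (half_pos hc)] with y hy hPy hyx
    have e1 : Metric.infDist y A ^ 2 = ‖P y - y‖ ^ 2 := by rw [(hP y hy).2]
    have e2 : Metric.infDist x A ^ 2 = ‖P x - x‖ ^ 2 := by rw [(hP x hx).2]
    have l1 : Metric.infDist y A ^ 2 ≤ ‖P x - y‖ ^ 2 := by
      have := Metric.infDist_le_dist_of_mem (x := y) (hP x hx).1
      rw [dist_comm, dist_eq_norm] at this
      have h0 := Metric.infDist_nonneg (x := y) (s := A)
      gcongr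
    have l2 : Metric.infDist x A ^ 2 ≤ ‖P y - x‖ ^ 2 := by
      have := Metric.infDist_le_dist_of_mem (x := x) (hP y hy).1
      rw [dist_comm, dist_eq_norm] at this
      have h0 := Metric.infDist_nonneg (x := x) (s := A)
      gcongr
    rw [Metric.mem_ball, dist_eq_norm] at hyx
    rw [dist_eq_norm] at hPy
    have i1 : ‖P x - y‖ ^ 2 = ‖P x - x‖ ^ 2 + 2 * inner ℝ (x - P x) (y - x) + ‖y - x‖ ^ 2 := by
      have : P x - y = - ((x - P x) + (y - x)) := by abel
      rw [this, norm_neg, norm_add_sq_real, norm_sub_rev x (P x)]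
    have i2 : ‖P y - x‖ ^ 2 = ‖P y - y‖ ^ 2 - 2 * inner ℝ (x - P x) (y - x)
        + 2 * inner ℝ (P y - P x) (y - x) - ‖y - x‖ ^ 2 := by
      have h1 : P y - x = (P y - y) + (y - x) := by abel
      rw [h1, norm_add_sq_real]
      have h2 : P y - y = (P y - P x) - (x - P x) - (y - x) := by abel
      have h3 : inner ℝ (P y - y) (y - x) = inner ℝ (P y - P x) (y - x)
        - inner ℝ (x - P x) (y - x) - ‖y - x‖ ^ 2 := by
        rw [h2, inner_sub_left, inner_sub_left, real_inner_self_eq_norm_sq]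
      rw [h3]; ring
    have cs := abs_real_inner_le_norm (P y - P x) (y - x)
    have cs2 : ‖P y - P x‖ * ‖y - x‖ ≤ c / 4 * ‖y - x‖ := by gcongr
    have cs3 : ‖y - x‖ ^ 2 ≤ c / 2 * ‖y - x‖ := by
      rw [sq]; gcongr
    have cs4 := abs_le.1 (cs.trans cs2)
    have hn : 0 ≤ c * ‖y - x‖ := by positivity
    rw [innerSL_apply_apply, inner_smul_left]
    simp only [conj_trivial]
    rw [Real.norm_eq_abs, abs_le]
    have hsq := sq_nonneg ‖y - x‖
    constructor <;> linarith [cs4.1, cs4.2]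
  have hsq : ContDiffOn ℝ 1 (fun y => Metric.infDist y A ^ 2) U := by
    rw [show (1 : WithTop ℕ∞) = 0 + 1 by simp, contDiffOn_succ_iff_fderiv_of_isOpen hUo]
    refine ⟨fun x hx => (hder x hx).differentiableAt.differentiableWithinAt, by simp, ?_⟩
    rw [contDiffOn_zero]
    have hc : ContinuousOn (fun x => innerSL ℝ ((2:ℝ) • (x - P x))) U := by
      have : ContinuousOn P U := fun x hx => (hcont x hx).continuousWithinAt
      have h2 : ContinuousOn (fun x => (2:ℝ) • (x - P x)) U := by fun_prop
      exact (innerSL ℝ).continuous.comp_continuousOn h2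
    exact hc.congr (fun x hx => (hder x hx).fderiv)
  have := hsq.sqrt (fun x hx => by have := hx.1; positivity)
  refine this.congr (fun x hx => ?_)
  rw [Real.sqrt_sq hx.1.le]

/-- Ekeland-type ascent lemma. -/
lemma aux_ascent {X : Type*} [MetricSpace X] [CompleteSpace X] (d : X → ℝ) (hd : Continuous d)
    (k ρ : ℝ) (hk : 0 < k) (x0 : X) (hx0 : d x0 ≤ ρ)
    (hstep : ∀ z, d x0 ≤ d z → d z < ρ → ∃ z', d z < d z' ∧ d z' ≤ ρ ∧
      k * dist z' z ≤ d z' - d z) :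
    ∃ z, d z = ρ ∧ k * dist z x0 ≤ ρ - d x0 := by
  let S : X → Set X := fun z => {z' | d z' ≤ ρ ∧ k * dist z' z ≤ d z' - d z}
  have hself : ∀ z, d z ≤ ρ → z ∈ S z := fun z hz => ⟨hz, by simp⟩
  have htrans : ∀ x y z, y ∈ S x → z ∈ S y → z ∈ S x := by
    intro x y z hy hz
    refine ⟨hz.1, ?_⟩
    have := hy.2
    have := hz.2
    have := mul_le_mul_of_nonneg_left (dist_triangle z y x) hk.le
    linarith
  have hbdd : ∀ z, BddAbove (d '' S z) := by
    intro z
    refine ⟨ρ, ?_⟩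
    rintro _ ⟨w, hw, rfl⟩
    exact hw.1
  have hnext : ∀ z : X, ∃ z', d z ≤ ρ → z' ∈ S z ∧ ∀ w ∈ S z, d w ≤ 2 * d z' - d z := by
    intro z
    by_cases hz : d z ≤ ρ
    swap
    · exact ⟨z, fun h => absurd h hz⟩
    have hle : d z ≤ sSup (d '' S z) := le_csSup (hbdd z) ⟨z, hself z hz, rfl⟩
    rcases hle.eq_or_lt with heq | hlt
    · refine ⟨z, fun _ => ⟨hself z hz, fun w hw => ?_⟩⟩
      have := le_csSup (hbdd z) ⟨w, hw, rfl⟩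
      linarith
    · obtain ⟨_, ⟨z', hz', rfl⟩, h⟩ := exists_lt_of_lt_csSup (s := d '' S z)
        (b := (d z + sSup (d '' S z)) / 2) ⟨_, z, hself z hz, rfl⟩ (by linarith)
      refine ⟨z', fun _ => ⟨hz', fun w hw => ?_⟩⟩
      have := le_csSup (hbdd z) ⟨w, hw, rfl⟩
      linarith
  choose nx hnx using hnext
  let s : ℕ → X := fun n => nx^[n] x0
  have hs1 : ∀ n, s (n + 1) = nx (s n) := fun n => Function.iterate_succ_apply' nx n x0
  have hsρ : ∀ n, d (s n) ≤ ρ := by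
    intro n
    induction n with
    | zero => exact hx0
    | succ n ih => rw [hs1]; exact (hnx _ ih).1.1
  have hsS : ∀ n m, n ≤ m → s m ∈ S (s n) := by
    intro n m hnm
    induction m, hnm using Nat.le_induction with
    | base => exact hself _ (hsρ n)
    | succ m _ ih =>
      refine htrans _ _ _ ih ?_
      rw [hs1]; exact (hnx _ (hsρ m)).1
  have hmono : Monotone (fun n => d (s n)) := by
    intro n m hnm
    have h1 := (hsS n m hnm).2
    have : 0 ≤ k * dist (s m) (s n) := by positivity
    simp only; linarith
  have hdconv : ∃ l, Filter.Tendsto (fun n => d (s n)) Filter.atTop (nhds l) :=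
    ⟨_, tendsto_atTop_ciSup hmono ⟨ρ, by rintro _ ⟨n, rfl⟩; exact hsρ n⟩⟩
  obtain ⟨l, hl⟩ := hdconv
  have hcau : CauchySeq s := by
    have hc := hl.cauchySeq
    rw [Metric.cauchySeq_iff'] at hc ⊢
    intro ε hε
    obtain ⟨N, hN⟩ := hc (k * ε) (by positivity)
    refine ⟨N, fun n hn => ?_⟩
    have h1 := hN n hn
    have h2 := (hsS N n hn).2
    rw [Real.dist_eq] at h1
    have h3 := le_abs_self (d (s n) - d (s N))
    exact lt_of_mul_lt_mul_left (by linarith) hk.le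
  obtain ⟨z, hz⟩ := cauchySeq_tendsto_of_complete hcau
  have hdz : Filter.Tendsto (fun n => d (s n)) Filter.atTop (nhds (d z)) :=
    (hd.tendsto z).comp hz
  have hzS : ∀ n, z ∈ S (s n) := by
    intro n
    refine ⟨le_of_tendsto' hdz hsρ, ?_⟩
    have t1 : Filter.Tendsto (fun m => k * dist (s m) (s n)) Filter.atTop
        (nhds (k * dist z (s n))) := (hz.dist tendsto_const_nhds).const_mul k
    have t2 : Filter.Tendsto (fun m => d (s m) - d (s n)) Filter.atTop
        (nhds (d z - d (s n))) := hdz.sub_const _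
    refine le_of_tendsto_of_tendsto t1 t2 ?_
    filter_upwards [Filter.eventually_ge_atTop n] with m hm
    exact (hsS n m hm).2
  have hz0 : z ∈ S x0 := hzS 0
  have hmax : ∀ w ∈ S z, d w ≤ d z := by
    intro w hw
    have h1 : ∀ n, d w ≤ 2 * d (s (n + 1)) - d (s n) := by
      intro n
      rw [hs1]
      exact (hnx _ (hsρ n)).2 w (htrans _ _ _ (hzS n) hw)
    have t : Filter.Tendsto (fun n => 2 * d (s (n + 1)) - d (s n)) Filter.atTop
        (nhds (2 * d z - d z)) :=
      ((hdz.comp (Filter.tendsto_add_atTop_nat 1)).const_mul 2).sub hdz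
    have := ge_of_tendsto' t h1
    linarith
  have hρ : d z = ρ := by
    by_contra hne
    have hlt : d z < ρ := lt_of_le_of_ne hz0.1 hne
    have h0 : 0 ≤ k * dist z x0 := by positivity
    obtain ⟨z', h1, h2, h3⟩ := hstep z (by linarith [hz0.2]) hlt
    have := hmax z' ⟨h2, h3⟩
    linarith
  exact ⟨z, hρ, by rw [← hρ]; exact hz0.2⟩

lemma aux_near {H : Type*} [NormedAddCommGroup H] [InnerProductSpace ℝ H]
    [CompleteSpace H] (A : Set H) (hA : IsClosed A) (x : H) (hx : 0 < Metric.infDist x A)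
    (hd : DifferentiableAt ℝ (fun y => Metric.infDist y A) x) :
    ∃ a ∈ A, ‖x - a‖ = Metric.infDist x A ∧
      fderiv ℝ (fun y => Metric.infDist y A) x (x - a) = Metric.infDist x A := by
  have hne : A.Nonempty := by
    by_contra h
    rw [Set.not_nonempty_iff_eq_empty] at h
    rw [h, Metric.infDist_empty] at hx
    exact lt_irrefl _ hx
  have hder := hd.hasFDerivAt
  have hL1 : ‖fderiv ℝ (fun y => Metric.infDist y A) x‖ ≤ 1 := by
    have := norm_fderiv_le_of_lipschitz ℝ (x₀ := x) (Metric.lipschitz_infDist_pt A)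
    simpa using this
  set L := fderiv ℝ (fun y => Metric.infDist y A) x with hL
  set r := Metric.infDist x A with hr
  have hlow : ∀ ε > 0, ∃ η > 0, ∀ a ∈ A, ‖x - a‖ ≤ r + η → r - ε ≤ L (x - a) := by
    intro ε hε
    rw [hasFDerivAt_iff_isLittleO, Asymptotics.isLittleO_iff] at hder
    have h1 := hder (c := ε / (2 * (r + 1))) (by positivity)
    rw [Metric.eventually_nhds_iff] at h1
    obtain ⟨δ, hδ, h1⟩ := h1
    have htpos : 0 < min 1 (δ / (2 * (r + 1))) := lt_min one_pos (by positivity)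
    have ht1 : min 1 (δ / (2 * (r + 1))) ≤ 1 := min_le_left _ _
    have ht2 : min 1 (δ / (2 * (r + 1))) ≤ δ / (2 * (r + 1)) := min_le_right _ _
    generalize min 1 (δ / (2 * (r + 1))) = t at htpos ht1 ht2
    rw [le_div_iff₀ (by positivity)] at ht2
    refine ⟨min 1 (t * ε / 2), lt_min one_pos (by positivity), ?_⟩
    intro a ha hax
    have hax1 : ‖x - a‖ ≤ r + 1 := hax.trans (by linarith [min_le_left 1 (t * ε / 2)])
    have hax2 : ‖x - a‖ ≤ r + t * ε / 2 := hax.trans (by linarith [min_le_right 1 (t * ε / 2)])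
    have hnorm : ‖(-t) • (x - a)‖ = t * ‖x - a‖ := by
      rw [norm_smul, norm_neg, Real.norm_of_nonneg htpos.le]
    have h2 := h1 (y := x + (-t) • (x - a)) (by
      rw [dist_eq_norm, add_sub_cancel_left, hnorm]
      nlinarith)
    rw [add_sub_cancel_left, hnorm, map_smul, smul_eq_mul, Real.norm_eq_abs] at h2
    have h3 := (abs_le.1 h2).1
    have h4 : Metric.infDist (x + (-t) • (x - a)) A ≤ (1 - t) * ‖x - a‖ := by
      refine (Metric.infDist_le_dist_of_mem ha).trans ?_
      rw [dist_eq_norm, show x + (-t) • (x - a) - a = (1 - t) • (x - a) by module,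
        norm_smul, Real.norm_of_nonneg (by linarith)]
    have h5 : ε / (2 * (r + 1)) * (t * ‖x - a‖) ≤ t * (ε / 2) := by
      calc ε / (2 * (r + 1)) * (t * ‖x - a‖) ≤ ε / (2 * (r + 1)) * (t * (r + 1)) := by gcongr
        _ = _ := by field_simp
    have h6 : t * (r - ε) ≤ t * L (x - a) := by
      have h7 : (1 - t) * ‖x - a‖ ≤ (1 - t) * (r + t * ε / 2) := by
        have : 0 ≤ 1 - t := by linarith
        gcongr
      have h8 : 0 ≤ t * (t * ε) := by positivity
      simp only [← hr] at h3
      nlinarith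
    exact le_of_mul_le_mul_left h6 htpos
  set u := (InnerProductSpace.toDual ℝ H).symm L with hu
  have hun : ‖u‖ ≤ 1 := by rw [hu, LinearIsometryEquiv.norm_map]; exact hL1
  have huL : ∀ v, inner ℝ u v = L v := fun v => InnerProductSpace.toDual_symm_apply
  have hmem : x - r • u ∈ A := by
    rw [← hA.closure_eq, Metric.mem_closure_iff]
    intro ε hε
    obtain ⟨η, hη, h⟩ := hlow (min 1 (ε ^ 2 / (16 * (r + 1)))) (lt_min one_pos (by positivity))
    have hη'pos : 0 < min η (min 1 (ε ^ 2 / (16 * (r + 1)))) :=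
      lt_min hη (lt_min one_pos (by positivity))
    obtain ⟨a, ha, hax⟩ := (Metric.infDist_lt_iff hne).1
      (show Metric.infDist x A < r + min η (min 1 (ε ^ 2 / (16 * (r + 1)))) by linarith)
    refine ⟨a, ha, ?_⟩
    have h1 := h a ha (by
      rw [← dist_eq_norm]; linarith [min_le_left η (min 1 (ε ^ 2 / (16 * (r + 1))))])
    rw [dist_eq_norm] at hax
    have h2 := min_le_right η (min 1 (ε ^ 2 / (16 * (r + 1))))
    have h3 := min_le_left 1 (ε ^ 2 / (16 * (r + 1)))
    have h4 := min_le_right 1 (ε ^ 2 / (16 * (r + 1)))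
    have hepos : 0 < min 1 (ε ^ 2 / (16 * (r + 1))) := lt_min one_pos (by positivity)
    generalize min 1 (ε ^ 2 / (16 * (r + 1))) = e at *
    rw [le_div_iff₀ (by positivity)] at h4
    have h5 : ‖x - a‖ ≤ r + e := by linarith
    rw [dist_comm, dist_eq_norm, show a - (x - r • u) = -((x - a) - r • u) by abel, norm_neg]
    have h6 : ‖(x - a) - r • u‖ ^ 2 < ε ^ 2 := by
      rw [norm_sub_sq_real, real_inner_smul_right, real_inner_comm, huL, norm_smul,
        Real.norm_of_nonneg hx.le]
      have h7 : ‖x - a‖ ^ 2 ≤ (r + e) ^ 2 := by gcongr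
      have h8 : (r * ‖u‖) ^ 2 ≤ (r * 1) ^ 2 := by gcongr
      have h9 : r * (r - e) ≤ r * L (x - a) := by gcongr
      nlinarith
    exact lt_of_pow_lt_pow_left₀ 2 hε.le h6
  have hnr : ‖x - (x - r • u)‖ = r * ‖u‖ := by
    rw [sub_sub_cancel, norm_smul, Real.norm_of_nonneg hx.le]
  have h1 : r ≤ r * ‖u‖ := by
    rw [← hnr, ← dist_eq_norm]; exact Metric.infDist_le_dist_of_mem hmem
  have h2 : ‖u‖ = 1 := le_antisymm hun (by
    by_contra hcon
    push Not at hcon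
    nlinarith)
  refine ⟨_, hmem, by rw [hnr, h2, mul_one], ?_⟩
  rw [sub_sub_cancel, map_smul, ← huL, real_inner_self_eq_norm_sq, h2]
  simp

lemma aux_prox {H : Type*} [NormedAddCommGroup H] [InnerProductSpace ℝ H]
    [CompleteSpace H] (A : Set H) (hA : IsClosed A) (hne : A.Nonempty) (R : ℝ)
    (hd : ∀ x, 0 < Metric.infDist x A → Metric.infDist x A < R →
      DifferentiableAt ℝ (fun y => Metric.infDist y A) x) (x : H) (hxR : Metric.infDist x A < R) :
    ∃ a ∈ A, ‖x - a‖ = Metric.infDist x A ∧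
      ∀ y ∈ A, 2 * R * inner ℝ (x - a) (y - a) ≤ ‖x - a‖ * ‖y - a‖ ^ 2 := by
  rcases (Metric.infDist_nonneg (x := x) (s := A)).eq_or_lt with h0 | hx
  · refine ⟨x, (hA.mem_iff_infDist_zero hne).2 h0.symm, by simp [← h0], by simp⟩
  obtain ⟨a, ha, hxa, -⟩ := aux_near A hA x hx (hd x hx hxR)
  refine ⟨a, ha, hxa, ?_⟩
  set r := Metric.infDist x A with hr
  have hball : ∀ ρ, r < ρ → ρ < R → ρ ≤ Metric.infDist (a + (ρ / r) • (x - a)) A := by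
    intro ρ hrρ hρR
    apply le_of_forall_pos_le_add
    intro ε hε
    -- choose k
    set T := ρ - r with hT
    have hTpos : 0 < T := by linarith
    set C := T ^ 2 * (1 + T / r) with hC
    have hCpos : 0 < C := by positivity
    set q := 1 + ε ^ 2 / C with hq
    have hq1 : 1 < q := by
      have : 0 < ε ^ 2 / C := by positivity
      linarith
    set k := 1 / Real.sqrt q with hk
    have hsq1 : 1 < Real.sqrt q := by rw [Real.lt_sqrt (by norm_num)]; linarith
    have hk0 : 0 < k := by positivity
    have hk1 : k < 1 := by rw [hk, div_lt_one (by linarith)]; exact hsq1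
    obtain ⟨z, hz1, hz2⟩ := aux_ascent (fun y => Metric.infDist y A)
      (Metric.continuous_infDist_pt A) k ρ hk0 x hrρ.le (by
        intro z hz0 hzρ
        have hzpos : 0 < Metric.infDist z A := by linarith
        obtain ⟨b, hb, hzb, hLb⟩ := aux_near A hA z hzpos (hd z hzpos (by linarith))
        have hder := (hd z hzpos (by linarith)).hasFDerivAt
        set L := fderiv ℝ (fun y => Metric.infDist y A) z
        set s := Metric.infDist z A with hs
        rw [hasFDerivAt_iff_isLittleO, Asymptotics.isLittleO_iff] at hder
        have h1 := hder (c := 1 - k) (by linarith)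
        rw [Metric.eventually_nhds_iff] at h1
        obtain ⟨δ, hδ, h1⟩ := h1
        have htpos : 0 < min (δ / 2) (ρ - s) := lt_min (by positivity) (by linarith)
        have ht1 := min_le_left (δ / 2) (ρ - s)
        have ht2 := min_le_right (δ / 2) (ρ - s)
        generalize min (δ / 2) (ρ - s) = t at htpos ht1 ht2
        have hnorm : ‖(t / s) • (z - b)‖ = t := by
          rw [norm_smul, Real.norm_of_nonneg (by positivity), hzb]; field_simp
        have h2 := h1 (y := z + (t / s) • (z - b)) (by
          rw [dist_eq_norm, add_sub_cancel_left, hnorm]; linarith)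
        have hdist : dist (z + (t / s) • (z - b)) z = t := by
          rw [dist_eq_norm, add_sub_cancel_left, hnorm]
        rw [add_sub_cancel_left, hnorm, map_smul, smul_eq_mul, Real.norm_eq_abs, hLb,
          div_mul_cancel₀ _ hzpos.ne'] at h2
        have h3 := (abs_le.1 h2).1
        have h4 := Metric.infDist_le_infDist_add_dist (s := A) (x := z + (t / s) • (z - b)) (y := z)
        rw [hdist] at h4
        simp only [← hs] at h3 h4
        have hkt : 0 < k * t := by positivity
        refine ⟨z + (t / s) • (z - b), ?_, ?_, ?_⟩
        · linarith
        · linarith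
        · rw [hdist]; linarith)
    simp only [← hr] at hz2 hz1
    rw [dist_eq_norm] at hz2
    have hp : ‖z - x‖ ^ 2 ≤ T ^ 2 * q := by
      have h1 : ‖z - x‖ ≤ T * Real.sqrt q := by
        rw [hk, one_div, inv_mul_le_iff₀ (by linarith)] at hz2
        linarith
      calc ‖z - x‖ ^ 2 ≤ (T * Real.sqrt q) ^ 2 := by gcongr
        _ = _ := by rw [mul_pow, Real.sq_sqrt (by linarith)]
    have hza : ρ ^ 2 ≤ ‖z - a‖ ^ 2 := by
      have : ρ ≤ ‖z - a‖ := by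
        rw [← hz1, ← dist_eq_norm]; exact Metric.infDist_le_dist_of_mem ha
      gcongr
      linarith
    have hexp : ‖z - a‖ ^ 2 = ‖z - x‖ ^ 2 + 2 * inner ℝ (z - x) (x - a) + r ^ 2 := by
      rw [show z - a = (z - x) + (x - a) by abel, norm_add_sq_real, hxa]
    have hzw : ‖z - (a + (ρ / r) • (x - a))‖ ^ 2 ≤ ε ^ 2 := by
      have : z - (a + (ρ / r) • (x - a)) = (z - x) - (T / r) • (x - a) := by
        have : ρ / r = 1 + T / r := by rw [hT]; field_simp; ring
        rw [this]; module
      rw [this, norm_sub_sq_real, real_inner_smul_right, norm_smul, hxa,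
        Real.norm_of_nonneg (by positivity), div_mul_cancel₀ _ hx.ne']
      have h1 : ρ ^ 2 - T ^ 2 * q - r ^ 2 ≤ 2 * inner ℝ (z - x) (x - a) := by linarith
      have h2 : (T / r) * (ρ ^ 2 - T ^ 2 * q - r ^ 2) ≤ (T / r) * (2 * inner ℝ (z - x) (x - a)) := by
        gcongr
      have h3 : T ^ 2 * q + T ^ 2 - (T / r) * (ρ ^ 2 - T ^ 2 * q - r ^ 2) = C * (q - 1) := by
        rw [hC, show ρ = T + r by rw [hT]; ring]; field_simp; ring
      have h4 : C * (q - 1) = ε ^ 2 := by rw [hq]; field_simp; ring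
      linarith
    have hzw' : ‖z - (a + (ρ / r) • (x - a))‖ ≤ ε :=
      (pow_le_pow_iff_left₀ (norm_nonneg _) hε.le two_ne_zero).1 hzw
    have := Metric.infDist_le_infDist_add_dist (s := A) (x := z) (y := a + (ρ / r) • (x - a))
    rw [hz1, dist_eq_norm] at this
    linarith
  intro y hy
  have hmain : ∀ ρ, r < ρ → ρ < R → 2 * ρ * inner ℝ (x - a) (y - a) ≤ r * ‖y - a‖ ^ 2 := by
    intro ρ h1 h2
    have h3 := (hball ρ h1 h2).trans (Metric.infDist_le_dist_of_mem hy)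
    rw [dist_eq_norm] at h3
    have hρ : 0 < ρ := by linarith
    have h4 : ρ ^ 2 ≤ ‖a + (ρ / r) • (x - a) - y‖ ^ 2 := by gcongr
    rw [show a + (ρ / r) • (x - a) - y = (ρ / r) • (x - a) - (y - a) by abel, norm_sub_sq_real,
      real_inner_smul_left, norm_smul, hxa, Real.norm_of_nonneg (by positivity),
      div_mul_cancel₀ _ hx.ne'] at h4
    have h5 : 2 * (ρ / r * inner ℝ (x - a) (y - a)) ≤ ‖y - a‖ ^ 2 := by linarith
    have h6 := mul_le_mul_of_nonneg_left h5 hx.le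
    have h7 : r * (2 * (ρ / r * inner ℝ (x - a) (y - a))) = 2 * ρ * inner ℝ (x - a) (y - a) := by
      field_simp
    linarith
  rw [hxa]
  have ht : Filter.Tendsto (fun ρ : ℝ => 2 * ρ * inner ℝ (x - a) (y - a)) (nhdsWithin R (Set.Iio R))
      (nhds (2 * R * inner ℝ (x - a) (y - a))) :=
    Filter.Tendsto.mono_left (Continuous.tendsto (by fun_prop) R) nhdsWithin_le_nhds
  refine le_of_tendsto ht ?_
  filter_upwards [Ioo_mem_nhdsLT hxR] with ρ hρ
  exact hmain ρ hρ.1 hρ.2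

set_option maxHeartbeats 800000 in
lemma aux_mid {H : Type*} [NormedAddCommGroup H] [InnerProductSpace ℝ H]
    (A : Set H) (R : ℝ) (hR : 0 < R)
    (hB : ∀ x, Metric.infDist x A < R → ∃ a ∈ A, ‖x - a‖ = Metric.infDist x A ∧
      ∀ y ∈ A, 2 * R * inner ℝ (x - a) (y - a) ≤ ‖x - a‖ * ‖y - a‖ ^ 2)
    (x0 x1 : H) (hx0 : x0 ∈ A) (hx1 : x1 ∈ A) (β : ℝ) (hβ0 : 0 ≤ β) (hβ : β < Real.pi / 2)
    (hc : ‖x0 - x1‖ ≤ 2 * R * Real.sin β) :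
    ∃ z ∈ A, ‖x0 - z‖ ≤ 2 * R * Real.sin (β / 2) ∧ ‖z - x1‖ ≤ 2 * R * Real.sin (β / 2) := by
  have hsin1 : Real.sin β < 1 := by
    rw [← Real.sin_pi_div_two]
    exact Real.sin_lt_sin_of_lt_of_le_pi_div_two (by linarith [Real.pi_pos]) le_rfl hβ
  have hcos : 0 < Real.cos β := Real.cos_pos_of_mem_Ioo ⟨by linarith [Real.pi_pos], hβ⟩
  have hsin0 : 0 ≤ Real.sin (β / 2) :=
    Real.sin_nonneg_of_nonneg_of_le_pi (by linarith) (by linarith [Real.pi_pos])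
  have hhalf : Real.cos β = 1 - 2 * Real.sin (β / 2) ^ 2 := by
    have h1 := Real.cos_two_mul (β / 2)
    have h2 := Real.sin_sq_add_cos_sq (β / 2)
    rw [show 2 * (β / 2) = β by ring] at h1
    linarith
  have hsc := Real.sin_sq_add_cos_sq β
  set c := ‖x0 - x1‖ with hcdef
  have hc0 : 0 ≤ c := norm_nonneg _
  set γ : ℝ → H := fun t => x0 + t • (x1 - x0) with hγ
  have hd0 : ∀ t ∈ Set.Icc (0:ℝ) 1, Metric.infDist (γ t) A ≤ t * c := by
    intro t ht
    refine (Metric.infDist_le_dist_of_mem hx0).trans ?_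
    rw [dist_eq_norm]; simp only [hγ]
    rw [add_sub_cancel_left, norm_smul, Real.norm_of_nonneg ht.1, norm_sub_rev]
  have hd1 : ∀ t ∈ Set.Icc (0:ℝ) 1, Metric.infDist (γ t) A ≤ (1 - t) * c := by
    intro t ht
    refine (Metric.infDist_le_dist_of_mem hx1).trans ?_
    rw [dist_eq_norm]; simp only [hγ]
    rw [show x0 + t • (x1 - x0) - x1 = (1 - t) • (x0 - x1) by module, norm_smul,
      Real.norm_of_nonneg (by linarith [ht.2])]
  have hdh : ∀ t ∈ Set.Icc (0:ℝ) 1, Metric.infDist (γ t) A ≤ c / 2 := by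
    intro t ht
    linarith [hd0 t ht, hd1 t ht]
  have hcR : c / 2 < R := by nlinarith
  have hex : ∀ t : ℝ, ∃ a, t ∈ Set.Icc (0:ℝ) 1 → a ∈ A ∧ ‖γ t - a‖ = Metric.infDist (γ t) A ∧
      ∀ y ∈ A, 2 * R * inner ℝ (γ t - a) (y - a) ≤ ‖γ t - a‖ * ‖y - a‖ ^ 2 := by
    intro t
    by_cases ht : t ∈ Set.Icc (0:ℝ) 1
    · obtain ⟨a, h1, h2, h3⟩ := hB (γ t) ((hdh t ht).trans_lt hcR)
      exact ⟨a, fun _ => ⟨h1, h2, h3⟩⟩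
    · exact ⟨x0, fun h => absurd h ht⟩
  choose P hP using hex
  have hlip : ∀ s ∈ Set.Icc (0:ℝ) 1, ∀ t ∈ Set.Icc (0:ℝ) 1,
      (R - c / 2) * ‖P s - P t‖ ≤ R * (c * |s - t|) := by
    intro s hs t ht
    obtain ⟨a1, a2, a3⟩ := hP s hs
    obtain ⟨b1, b2, b3⟩ := hP t ht
    have i1 := a3 _ b1
    have i2 := b3 _ a1
    have hγd : ‖γ s - γ t‖ = c * |s - t| := by
      simp only [hγ]
      rw [show x0 + s • (x1 - x0) - (x0 + t • (x1 - x0)) = (s - t) • (x1 - x0) by module,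
        norm_smul, norm_sub_rev x1 x0, Real.norm_eq_abs, mul_comm]
    have e1 : inner ℝ (γ s - P s) (P t - P s) + inner ℝ (γ t - P t) (P s - P t)
        = ‖P s - P t‖ ^ 2 - inner ℝ (γ s - γ t) (P s - P t) := by
      rw [← neg_sub (P s) (P t), inner_neg_right, ← real_inner_self_eq_norm_sq]
      have : γ s - γ t = (γ s - P s) + (P s - P t) - (γ t - P t) := by abel
      have h3 : inner ℝ (γ s - γ t) (P s - P t) = inner ℝ (γ s - P s) (P s - P t)
          + inner ℝ (P s - P t) (P s - P t) - inner ℝ (γ t - P t) (P s - P t) := by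
        rw [this, inner_sub_left (γ s - P s + (P s - P t)), inner_add_left (γ s - P s)]
      rw [h3]; ring
    have cs := real_inner_le_norm (γ s - γ t) (P s - P t)
    rw [hγd] at cs
    have n1 : ‖P t - P s‖ = ‖P s - P t‖ := norm_sub_rev _ _
    rw [n1, a2] at i1
    rw [b2] at i2
    have j1 : Metric.infDist (γ s) A * ‖P s - P t‖ ^ 2 ≤ c / 2 * ‖P s - P t‖ ^ 2 := by
      have := hdh s hs
      gcongr
    have j2 : Metric.infDist (γ t) A * ‖P s - P t‖ ^ 2 ≤ c / 2 * ‖P s - P t‖ ^ 2 := by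
      have := hdh t ht
      gcongr
    have hsum : 2 * R * (‖P s - P t‖ ^ 2 - inner ℝ (γ s - γ t) (P s - P t))
        ≤ c * ‖P s - P t‖ ^ 2 := by
      rw [← e1, mul_add]; linarith
    have cs' : 2 * R * inner ℝ (γ s - γ t) (P s - P t) ≤ 2 * R * (c * |s - t| * ‖P s - P t‖) := by
      gcongr
    generalize inner ℝ (γ s - γ t) (P s - P t) = I at hsum cs'
    have hst : 0 ≤ |s - t| := abs_nonneg _
    generalize |s - t| = q at *
    rcases (norm_nonneg (P s - P t)).eq_or_lt with h | h
    · rw [← h, mul_zero]; positivity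
    · refine le_of_mul_le_mul_right ?_ h
      have e2 : (R - c / 2) * ‖P s - P t‖ * ‖P s - P t‖
        = R * ‖P s - P t‖ ^ 2 - c * ‖P s - P t‖ ^ 2 / 2 := by ring
      linarith
  have hcont : ContinuousOn P (Set.Icc 0 1) := by
    have hpos : 0 < R - c / 2 := by linarith
    have : LipschitzOnWith (Real.toNNReal (R * c / (R - c / 2))) P (Set.Icc 0 1) := by
      apply LipschitzOnWith.of_dist_le_mul
      intro s hs t ht
      rw [Real.coe_toNNReal _ (by positivity), dist_eq_norm, Real.dist_eq, div_mul_eq_mul_div,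
        le_div_iff₀ hpos]
      linarith [hlip s hs t ht]
    exact this.continuousOn
  set m := (1/2:ℝ) • (x0 + x1) with hm
  have hP0 : P 0 = x0 := by
    have h := (hP 0 (by simp)).2.1
    have h2 := hd0 0 (by simp)
    rw [← h, zero_mul] at h2
    have h3 := norm_le_zero_iff.1 h2
    rw [sub_eq_zero] at h3
    rw [← h3]; simp [hγ]
  have hP1 : P 1 = x1 := by
    have h := (hP 1 (by simp)).2.1
    have h2 := hd1 1 (by simp)
    rw [← h, sub_self, zero_mul] at h2
    have h3 := norm_le_zero_iff.1 h2
    rw [sub_eq_zero] at h3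
    rw [← h3]; simp [hγ]
  have hivt := intermediate_value_Icc (zero_le_one' ℝ)
    (f := fun t => inner ℝ (P t - m) (x1 - x0)) (by fun_prop)
  obtain ⟨t, ht, hinn⟩ := hivt (show (0:ℝ) ∈ _ by
    simp only [hP0, hP1]
    rw [show x0 - m = (-(1/2:ℝ)) • (x1 - x0) by rw [hm]; module,
      show x1 - m = (1/2:ℝ) • (x1 - x0) by rw [hm]; module, real_inner_smul_left,
      real_inner_smul_left, real_inner_self_eq_norm_sq]
    constructor <;> linarith [sq_nonneg ‖x1 - x0‖])
  simp only at hinn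
  obtain ⟨a1, a2, a3⟩ := hP t ht
  have hrc := hdh t ht
  rw [← a2] at hrc
  set z := P t with hz
  set r := ‖γ t - z‖ with hr
  have hr0 : 0 ≤ r := norm_nonneg _
  -- equal distances
  have hs0 : ‖x0 - z‖ ^ 2 = c ^ 2 / 4 + ‖z - m‖ ^ 2 := by
    rw [show x0 - z = -((z - m) + (1/2:ℝ) • (x1 - x0)) by rw [hm]; module, norm_neg,
      norm_add_sq_real, real_inner_smul_right, hinn, norm_smul, norm_sub_rev x1 x0]
    norm_num; ring
  have hs1 : ‖z - x1‖ ^ 2 = c ^ 2 / 4 + ‖z - m‖ ^ 2 := by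
    rw [show z - x1 = (z - m) - (1/2:ℝ) • (x1 - x0) by rw [hm]; module,
      norm_sub_sq_real, real_inner_smul_right, hinn, norm_smul, norm_sub_rev x1 x0]
    norm_num; ring
  have hzm : ‖z - m‖ ^ 2 ≤ r ^ 2 := by
    have : γ t - z = (t - 1/2) • (x1 - x0) - (z - m) := by simp only [hγ, hm]; module
    have h2 : ‖γ t - z‖ ^ 2 = ‖(t - 1/2) • (x1 - x0)‖ ^ 2 + ‖z - m‖ ^ 2 := by
      rw [this, norm_sub_sq_real ((t - 1/2) • (x1 - x0)), real_inner_smul_left, real_inner_comm,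
        hinn]
      ring
    rw [hr, h2]
    linarith [sq_nonneg ‖(t - 1/2) • (x1 - x0)‖]
  obtain ⟨S, hS⟩ : ∃ S, S = c ^ 2 / 4 + ‖z - m‖ ^ 2 := ⟨_, rfl⟩
  rw [← hS] at hs0 hs1
  have i0 := a3 _ hx0
  have i1 := a3 _ hx1
  rw [norm_sub_rev x1 z, hs1] at i1
  rw [hs0] at i0
  have hcomb : r ^ 2 = (1 - t) * inner ℝ (γ t - z) (x0 - z) + t * inner ℝ (γ t - z) (x1 - z) := by
    rw [hr, ← real_inner_self_eq_norm_sq]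
    nth_rewrite 2 [show γ t - z = (1 - t) • (x0 - z) + t • (x1 - z) by simp only [hγ]; module]
    rw [inner_add_right, real_inner_smul_right, real_inner_smul_right]
  have hrS : 2 * R * r ^ 2 ≤ r * S := by
    have k0 := mul_le_mul_of_nonneg_left i0 (show 0 ≤ 1 - t by linarith [ht.2])
    have k1 := mul_le_mul_of_nonneg_left i1 ht.1
    have e1 : r * S = (1 - t) * (r * S) + t * (r * S) := by ring
    rw [hcomb, e1]; linarith
  have hS0 : 0 ≤ S := by rw [hS]; positivity
  have hrS' : 2 * R * r ≤ S := by
    rcases hr0.eq_or_lt with h | h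
    · rw [← h]; simpa using hS0
    · refine le_of_mul_le_mul_left ?_ h
      have : r * (2 * R * r) = 2 * R * r ^ 2 := by ring
      linarith
  have hc2 : c ^ 2 / 4 ≤ R ^ 2 * Real.sin β ^ 2 := by
    have : c ^ 2 ≤ (2 * R * Real.sin β) ^ 2 := by gcongr
    have h2 : (2 * R * Real.sin β) ^ 2 = 4 * (R ^ 2 * Real.sin β ^ 2) := by ring
    linarith
  have hRr : R * Real.cos β ≤ R - r := by
    have hsq : (R * Real.cos β) ^ 2 ≤ (R - r) ^ 2 := by
      have e1 : (R * Real.cos β) ^ 2 = R ^ 2 - R ^ 2 * Real.sin β ^ 2 := by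
        rw [mul_pow, show Real.cos β ^ 2 = 1 - Real.sin β ^ 2 by linarith]; ring
      have e2 : (R - r) ^ 2 = R ^ 2 - 2 * R * r + r ^ 2 := by ring
      linarith
    exact (pow_le_pow_iff_left₀ (by positivity) (by linarith) two_ne_zero).1 hsq
  have hSfin : S ≤ (2 * R * Real.sin (β / 2)) ^ 2 := by
    have h1 : r ^ 2 ≤ (R * (1 - Real.cos β)) ^ 2 := by
      have : r ≤ R * (1 - Real.cos β) := by linarith
      gcongr
    have h2 : R ^ 2 * Real.sin β ^ 2 + (R * (1 - Real.cos β)) ^ 2 = 2 * R ^ 2 * (1 - Real.cos β) := by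
      rw [show Real.sin β ^ 2 = 1 - Real.cos β ^ 2 by linarith]; ring
    have h3 : 2 * R ^ 2 * (1 - Real.cos β) = (2 * R * Real.sin (β / 2)) ^ 2 := by
      rw [hhalf]; ring
    linarith
  refine ⟨z, a1, ?_, ?_⟩
  · exact (pow_le_pow_iff_left₀ (norm_nonneg _) (by positivity) two_ne_zero).1 (by linarith)
  · exact (pow_le_pow_iff_left₀ (norm_nonneg _) (by positivity) two_ne_zero).1 (by linarith)

def dyad {H : Type*} (mid : H → H → ℕ → H) (x0 x1 : H) : ℕ → ℕ → H
  | 0, k => if k = 0 then x0 else x1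
  | n + 1, k => if k % 2 = 0 then dyad mid x0 x1 n (k / 2)
      else mid (dyad mid x0 x1 n (k / 2)) (dyad mid x0 x1 n (k / 2 + 1)) n

lemma aux_curve {H : Type*} [NormedAddCommGroup H] [InnerProductSpace ℝ H]
    [CompleteSpace H] (A : Set H) (hA : IsClosed A) (R : ℝ) (hR : 0 < R)
    (hmid : ∀ x0 x1 : H, x0 ∈ A → x1 ∈ A → ∀ β : ℝ, 0 ≤ β → β < Real.pi / 2 →
      ‖x0 - x1‖ ≤ 2 * R * Real.sin β →
      ∃ z ∈ A, ‖x0 - z‖ ≤ 2 * R * Real.sin (β / 2) ∧ ‖z - x1‖ ≤ 2 * R * Real.sin (β / 2))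
    (x0 x1 : H) (hx0 : x0 ∈ A) (hx1 : x1 ∈ A) (β : ℝ) (hβ0 : 0 ≤ β) (hβ : β < Real.pi / 2)
    (hc : ‖x0 - x1‖ ≤ 2 * R * Real.sin β) :
    ∃ f : ℝ → H, IsCurveIn A x0 x1 f ∧
      eVariationOn f (Set.Icc 0 1) ≤ ENNReal.ofReal (2 * R * β) := by
  have hex : ∀ (a b : H) (n : ℕ), ∃ z, a ∈ A → b ∈ A →
      ‖a - b‖ ≤ 2 * R * Real.sin (β / 2 ^ n) →
      z ∈ A ∧ ‖a - z‖ ≤ 2 * R * Real.sin (β / 2 ^ (n + 1)) ∧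
        ‖z - b‖ ≤ 2 * R * Real.sin (β / 2 ^ (n + 1)) := by
    intro a b n
    by_cases h : a ∈ A ∧ b ∈ A ∧ ‖a - b‖ ≤ 2 * R * Real.sin (β / 2 ^ n)
    · have hle : β / 2 ^ n ≤ β := div_le_self hβ0 (one_le_pow₀ (by norm_num))
      obtain ⟨z, h1, h2, h3⟩ := hmid a b h.1 h.2.1 (β / 2 ^ n) (by positivity)
        (by linarith) h.2.2
      rw [show β / 2 ^ n / 2 = β / 2 ^ (n + 1) by rw [pow_succ]; field_simp] at h2 h3
      exact ⟨z, fun _ _ _ => ⟨h1, h2, h3⟩⟩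
    · exact ⟨a, fun h1 h2 h3 => absurd ⟨h1, h2, h3⟩ h⟩
  choose mid hmid' using hex
  set F := dyad mid x0 x1 with hF
  have hFe : ∀ n k, F (n + 1) (2 * k) = F n k := by
    intro n k
    rw [hF, dyad, if_pos (by omega), show 2 * k / 2 = k by omega]
  have hFo : ∀ n k, F (n + 1) (2 * k + 1) = mid (F n k) (F n (k + 1)) n := by
    intro n k
    rw [hF, dyad, if_neg (by omega), show (2 * k + 1) / 2 = k by omega]
  have hmain : ∀ n k, F n k ∈ A ∧ ‖F n k - F n (k + 1)‖ ≤ 2 * R * Real.sin (β / 2 ^ n) := by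
    intro n
    induction n with
    | zero =>
      intro k
      have hs : 0 ≤ Real.sin β :=
        Real.sin_nonneg_of_nonneg_of_le_pi hβ0 (by linarith [Real.pi_pos])
      rcases Nat.eq_zero_or_pos k with h | h
      · subst h
        simp only [hF, dyad]
        simpa using ⟨hx0, hc⟩
      · simp only [hF, dyad]
        rw [if_neg (by omega), if_neg (by omega)]
        refine ⟨hx1, ?_⟩
        simp; positivity
    | succ n ih =>
      intro k
      obtain ⟨j, hj | hj⟩ := Nat.even_or_odd' k
      · have h := hmid' (F n j) (F n (j + 1)) n (ih j).1 (ih (j+1)).1 (ih j).2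
        rw [hj, hFe, hFo]
        exact ⟨(ih j).1, h.2.1⟩
      · have h := hmid' (F n j) (F n (j + 1)) n (ih j).1 (ih (j+1)).1 (ih j).2
        rw [hj, hFo, show 2 * j + 1 + 1 = 2 * (j + 1) by ring, hFe]
        exact ⟨h.1, h.2.2⟩
  set L := 2 * R * β with hL
  have hL0 : 0 ≤ L := by positivity
  have hstep : ∀ n k, dist (F n k) (F n (k + 1)) ≤ L / 2 ^ n := by
    intro n k
    rw [dist_eq_norm]
    refine (hmain n k).2.trans ?_
    have := Real.sin_le (x := β / 2 ^ n) (by positivity)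
    calc 2 * R * Real.sin (β / 2 ^ n) ≤ 2 * R * (β / 2 ^ n) := by gcongr
      _ = _ := by rw [hL]; ring
  have hFdist : ∀ n j k, j ≤ k → dist (F n j) (F n k) ≤ (k - j : ℝ) * (L / 2 ^ n) := by
    intro n j k hjk
    have := dist_le_Ico_sum_of_dist_le (f := F n) hjk (d := fun _ => L / 2 ^ n)
      (fun {k} _ _ => hstep n k)
    simp only [Finset.sum_const, Nat.card_Ico, nsmul_eq_mul] at this
    rwa [Nat.cast_sub hjk] at this
  have hF0 : ∀ n, F n 0 = x0 := by
    intro n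
    induction n with
    | zero => simp [hF, dyad]
    | succ n ih => rw [← ih]; exact hFe n 0
  have hF1 : ∀ n, F n (2 ^ n) = x1 := by
    intro n
    induction n with
    | zero => simp [hF, dyad]
    | succ n ih => rw [← ih, pow_succ, mul_comm]; exact hFe n _
  let g : ℕ → ℝ → H := fun n t => F n ⌊2 ^ n * t⌋₊
  have hgA : ∀ n t, g n t ∈ A := fun n t => (hmain n _).1
  have hgs : ∀ t, 0 ≤ t → ∀ n, dist (g n t) (g (n + 1) t) ≤ L / 2 / 2 ^ n := by
    intro t ht n
    simp only [g]
    set y := 2 ^ n * t with hy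
    have hy0 : 0 ≤ y := by positivity
    rw [show (2:ℝ) ^ (n + 1) * t = 2 * y by rw [hy]; ring]
    have h1 : 2 * ⌊y⌋₊ ≤ ⌊2 * y⌋₊ := by
      apply Nat.le_floor; push_cast
      linarith [Nat.floor_le hy0]
    have h2 : ⌊2 * y⌋₊ < 2 * ⌊y⌋₊ + 2 := by
      rw [Nat.floor_lt (by positivity)]; push_cast
      linarith [Nat.lt_floor_add_one y]
    rw [← hFe n ⌊y⌋₊, div_div, ← pow_succ']
    rcases (show ⌊2 * y⌋₊ = 2 * ⌊y⌋₊ ∨ ⌊2 * y⌋₊ = 2 * ⌊y⌋₊ + 1 by omega) with h | h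
    · rw [h, dist_self]; positivity
    · rw [h]; exact hstep _ _
  have hlim : ∀ t : ℝ, ∃ p, 0 ≤ t → Filter.Tendsto (fun n => g n t) Filter.atTop (nhds p) := by
    intro t
    by_cases ht : 0 ≤ t
    · obtain ⟨p, hp⟩ := cauchySeq_tendsto_of_complete (cauchySeq_of_le_geometric_two (hgs t ht))
      exact ⟨p, fun _ => hp⟩
    · exact ⟨x0, fun h => absurd h ht⟩
  choose f hf using hlim
  have hlipf : ∀ s t, 0 ≤ s → s ≤ t → dist (f s) (f t) ≤ L * (t - s) := by
    intro s t hs hst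
    have ht : 0 ≤ t := hs.trans hst
    have t1 := (hf s hs).dist (hf t ht)
    have t2 : Filter.Tendsto (fun n : ℕ => L * (t - s) + L / 2 ^ n) Filter.atTop
        (nhds (L * (t - s) + 0)) := by
      refine tendsto_const_nhds.add ?_
      have := (tendsto_pow_atTop_nhds_zero_of_lt_one (r := (1/2:ℝ)) (by norm_num)
        (by norm_num)).const_mul L
      rw [mul_zero] at this
      refine this.congr (fun n => ?_)
      rw [one_div, inv_pow]; rfl
    rw [add_zero] at t2
    refine le_of_tendsto_of_tendsto' t1 t2 (fun n => ?_)
    have hfl : ⌊2 ^ n * s⌋₊ ≤ ⌊2 ^ n * t⌋₊ := Nat.floor_mono (by gcongr)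
    refine (hFdist n _ _ hfl).trans ?_
    have h1 := Nat.floor_le (show 0 ≤ 2 ^ n * t by positivity)
    have h2 := Nat.lt_floor_add_one (2 ^ n * s)
    calc ((⌊2 ^ n * t⌋₊ : ℝ) - ⌊2 ^ n * s⌋₊) * (L / 2 ^ n)
        ≤ (2 ^ n * (t - s) + 1) * (L / 2 ^ n) := by
          gcongr; linarith
      _ = _ := by field_simp
  have hlip : LipschitzOnWith (Real.toNNReal L) f (Set.Icc 0 1) := by
    apply LipschitzOnWith.of_dist_le_mul
    intro s hs t ht
    rw [Real.coe_toNNReal _ hL0, Real.dist_eq]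
    rcases le_total s t with h | h
    · rw [abs_sub_comm, abs_of_nonneg (by linarith)]
      exact hlipf s t hs.1 h
    · rw [dist_comm, abs_of_nonneg (by linarith)]
      exact hlipf t s ht.1 h
  refine ⟨f, ⟨hlip.continuousOn, ?_, ?_, ?_⟩, ?_⟩
  · refine tendsto_nhds_unique (hf 0 le_rfl) ?_
    refine tendsto_const_nhds.congr (fun n => ?_)
    simp [g, hF0]
  · refine tendsto_nhds_unique (hf 1 zero_le_one) ?_
    refine tendsto_const_nhds.congr (fun n => ?_)
    simp only [g, mul_one]
    rw [show ((2:ℝ) ^ n) = ((2 ^ n : ℕ) : ℝ) by push_cast; rfl, Nat.floor_natCast, hF1]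
  · rintro _ ⟨t, ht, rfl⟩
    exact hA.mem_of_tendsto (hf t ht.1) (Filter.Eventually.of_forall (fun n => hgA n t))
  · have h1 := hlip.comp_eVariationOn_le (g := fun t : ℝ => t) (s := Set.Icc 0 1)
      (fun t ht => ht)
    refine h1.trans ?_
    have h2 := MonotoneOn.eVariationOn_eq (f := fun t : ℝ => t) (s := Set.Icc (0:ℝ) 1)
      (fun x _ y _ h => h) (a := 0) (b := 1) (by simp) (by simp)
    rw [Set.inter_self] at h2
    calc _ ≤ (Real.toNNReal L : ENNReal) * ENNReal.ofReal (1 - 0) := by gcongr; exact h2.le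
      _ = _ := by simp [ENNReal.ofReal]

theorem statement0 {H : Type*} [NormedAddCommGroup H] [InnerProductSpace ℝ H]
    [CompleteSpace H] (A : Set H) (hA : IsClosed A) (R : ℝ) (hR : 0 < R) :
    ProximallySmooth A R ↔
      ∀ x0 ∈ A, ∀ x1 ∈ A, x0 ≠ x1 → ‖x0 - x1‖ < 2 * R →
        ∃ f : ℝ → H, IsCurveIn A x0 x1 f ∧
          eVariationOn f (Set.Icc 0 1) ≤
            ENNReal.ofReal (2 * R * Real.arcsin (‖x0 - x1‖ / (2 * R))) := by
  constructor
  · rintro ⟨-, hcd⟩ x0 hx0 x1 hx1 - hc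
    have hUo : IsOpen {x : H | 0 < Metric.infDist x A ∧ Metric.infDist x A < R} :=
      (isOpen_lt continuous_const (Metric.continuous_infDist_pt A)).inter
        (isOpen_lt (Metric.continuous_infDist_pt A) continuous_const)
    have hd : ∀ x, 0 < Metric.infDist x A → Metric.infDist x A < R →
        DifferentiableAt ℝ (fun y => Metric.infDist y A) x := fun x h1 h2 =>
      (hcd.differentiableOn one_ne_zero).differentiableAt (hUo.mem_nhds ⟨h1, h2⟩)
    have hc1 : ‖x0 - x1‖ / (2 * R) < 1 := by rw [div_lt_one (by positivity)]; exact hc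
    have hc0 : 0 ≤ ‖x0 - x1‖ / (2 * R) := by positivity
    refine aux_curve A hA R hR
      (fun y0 y1 h0 h1 => aux_mid A R hR (aux_prox A hA ⟨x0, hx0⟩ R hd) y0 y1 h0 h1)
      x0 x1 hx0 hx1 _ (Real.arcsin_nonneg.2 hc0) (Real.arcsin_lt_pi_div_two.2 hc1) ?_
    rw [Real.sin_arcsin (by linarith) hc1.le]
    apply le_of_eq
    field_simp
  · intro h
    exact ⟨hA, aux_contDiff A hA R (fun x h0 h1 ε hε => aux_key A R hR h x h0 h1 ε hε)⟩
end
end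

section
/- Let X be a uniformly convex and uniformly smooth real Banach space, let A ⊂ X be a closed set, and let R > 0. The following assertions are equivalent: (1) A is proximally smooth with constant R; (2) for every u with 0 < dist(u, A) < R the metric projection P_A(u) is a single point and the map u ↦ P_A(u) is continuous on the open R-neighborhood of A; (3) for every u with 0 < dist(u, A) < R and every x ∈ P_A(u), one has dist(x + (R/‖u − x‖)(u − x), A) ≥ R. -/
noncomputable section

open Set Metric

section helpers

variable {X : Type*} [NormedAddCommGroup X] [NormedSpace ℝ X]

theorem uc_aux [UniformConvexSpace X] {α β ε : ℝ} (hα : 0 < α) (hβ : 0 < β) (hε : 0 < ε) :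
    ∃ η₀ > 0, ∀ η > 0, η ≤ η₀ → ∀ a c : X, ‖a‖ ≤ α + η → ‖c‖ ≤ β + η → α + β - η ≤ ‖a + c‖ →
      ‖(1 / (α + η)) • a - (1 / (β + η)) • c‖ < ε := by
  obtain ⟨δ, hδ, h⟩ := exists_forall_closed_ball_dist_add_le_two_sub X hε
  have hμ : 0 < min α β := lt_min hα hβ
  refine ⟨min α β * δ / 4, by positivity, fun η hη hη' a c ha hc hac => ?_⟩
  by_contra! hcon
  have hA : 0 < α + η := by linarith
  have hB : 0 < β + η := by linarith
  set x := (1 / (α + η)) • a with hx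
  set y := (1 / (β + η)) • c with hy
  have hx1 : ‖x‖ ≤ 1 := by
    rw [hx, norm_smul, Real.norm_of_nonneg (by positivity), one_div, inv_mul_le_iff₀ hA]; linarith
  have hy1 : ‖y‖ ≤ 1 := by
    rw [hy, norm_smul, Real.norm_of_nonneg (by positivity), one_div, inv_mul_le_iff₀ hB]; linarith
  have h2 := h hx1 hy1 hcon
  have ea : a = (α + η) • x := by rw [hx, smul_smul, mul_one_div_cancel hA.ne', one_smul]
  have ec : c = (β + η) • y := by rw [hy, smul_smul, mul_one_div_cancel hB.ne', one_smul]
  set m := min α β with hm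
  have m1 : m ≤ α := min_le_left _ _
  have m2 : m ≤ β := min_le_right _ _
  have e : a + c = m • (x + y) + ((α + η - m) • x + (β + η - m) • y) := by
    rw [ea, ec]
    module
  have n1 : ‖a + c‖ ≤ m * ‖x + y‖ + ((α + η - m) * ‖x‖ + (β + η - m) * ‖y‖) := by
    rw [e]
    refine (norm_add_le _ _).trans (add_le_add ?_ ((norm_add_le _ _).trans (add_le_add ?_ ?_))) <;>
    · rw [norm_smul, Real.norm_of_nonneg (by linarith)]
  have n2 : m * ‖x + y‖ ≤ m * (2 - δ) := by gcongr
  have n3 : (α + η - m) * ‖x‖ ≤ (α + η - m) * 1 := by gcongr; linarith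
  have n4 : (β + η - m) * ‖y‖ ≤ (β + η - m) * 1 := by gcongr; linarith
  nlinarith [mul_pos hμ hδ]

theorem core [UniformConvexSpace X] {α β ε : ℝ} (hα : 0 < α) (hβ : 0 < β) (hε : 0 < ε) :
    ∃ η > 0, ∀ a b c : X, ‖a‖ ≤ α + η → ‖b‖ ≤ α + η → ‖c‖ ≤ β + η →
      α + β - η ≤ ‖a + c‖ → α + β - η ≤ ‖b + c‖ → ‖a - b‖ < ε := by
  obtain ⟨η₀, h0, h⟩ := uc_aux (X := X) hα hβ (ε := ε / (4 * α)) (by positivity)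
  refine ⟨min η₀ α, lt_min h0 hα, fun a b c ha hb hc hac hbc => ?_⟩
  set η := min η₀ α with hη
  have hp : 0 < η := lt_min h0 hα
  have hηα : η ≤ α := min_le_right _ _
  have h1 := h η hp (min_le_left _ _) a c ha hc hac
  have h2 := h η hp (min_le_left _ _) b c hb hc hbc
  have hA : 0 < α + η := by linarith
  have e : a - b = (α + η) • (((1 / (α + η)) • a - (1 / (β + η)) • c) -
      ((1 / (α + η)) • b - (1 / (β + η)) • c)) := by
    rw [sub_sub_sub_cancel_right, ← smul_sub, smul_smul, mul_one_div_cancel hA.ne', one_smul]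
  rw [e, norm_smul, Real.norm_of_nonneg hA.le]
  have h3 := norm_sub_le ((1 / (α + η)) • a - (1 / (β + η)) • c)
      ((1 / (α + η)) • b - (1 / (β + η)) • c)
  calc _ < (α + η) * (ε / (4 * α) + ε / (4 * α)) := by
        apply mul_lt_mul_of_pos_left _ hA; linarith
    _ ≤ (α + α) * (ε / (4 * α) + ε / (4 * α)) := by gcongr
    _ = ε := by field_simp; ring

/-- continuity of the duality map -/
theorem duality_cont (hsm : UnifSmooth X) {v : X} (hv : v ≠ 0) {ε : ℝ} (hε : 0 < ε) :
    ∃ δ > 0, ∀ v' : X, ‖v' - v‖ < δ → ∀ f f' : X →L[ℝ] ℝ, ‖f‖ ≤ 1 → ‖f'‖ ≤ 1 → f v = ‖v‖ →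
      f' v' = ‖v'‖ → ‖f' - f‖ ≤ ε := by
  have hn : 0 < ‖v‖ := norm_pos_iff.2 hv
  obtain ⟨τ, hτ1, hτ⟩ : ∃ τ : ℝ, modSmooth X τ / τ < ε / 4 ∧ 0 < τ := by
    have h1 := hsm.eventually (gt_mem_nhds (show (0:ℝ) < ε / 4 by positivity))
    exact (h1.and self_mem_nhdsWithin).exists
  rw [div_lt_iff₀ hτ] at hτ1
  refine ⟨ε * τ * ‖v‖ / 4, by positivity, fun v' hv' f f' hf hf' hfv hfv' => ?_⟩
  have key : ∀ y : X, ‖y‖ = τ * ‖v‖ → (f - f') y ≤ ε * ‖y‖ := by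
    intro y hy
    have b1 : f (v + y) ≤ ‖v + y‖ := (le_abs_self _).trans ((f.le_opNorm _).trans
      (mul_le_of_le_one_left (norm_nonneg _) hf))
    have b2 : f' (v' - y) ≤ ‖v' - y‖ := (le_abs_self _).trans ((f'.le_opNorm _).trans
      (mul_le_of_le_one_left (norm_nonneg _) hf'))
    rw [map_add] at b1
    rw [map_sub] at b2
    have b3 : ‖v' - y‖ ≤ ‖v - y‖ + ‖v' - v‖ := by
      have : v' - y = (v - y) + (v' - v) := by abel
      rw [this]; exact norm_add_le _ _
    have b4 : ‖v‖ ≤ ‖v'‖ + ‖v' - v‖ := by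
      have := norm_sub_norm_le v v'; rw [norm_sub_rev] at this; linarith
    have b5 : (‖(‖v‖⁻¹) • v + (‖v‖⁻¹) • y‖ + ‖(‖v‖⁻¹) • v - (‖v‖⁻¹) • y‖) / 2 - 1
        ≤ modSmooth X τ := by
      apply le_csSup
      · refine ⟨τ, ?_⟩
        rintro r ⟨x, z, hx, hz, rfl⟩
        have := norm_add_le x z
        have := norm_sub_le x z
        linarith
      · refine ⟨_, _, ?_, ?_, rfl⟩
        · rw [norm_smul, norm_inv, norm_norm, inv_mul_cancel₀ hn.ne']
        · rw [norm_smul, norm_inv, norm_norm, hy]; field_simp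
    rw [← smul_add, ← smul_sub, norm_smul, norm_smul, norm_inv, norm_norm] at b5
    have b6 : ‖v + y‖ + ‖v - y‖ ≤ 2 * ‖v‖ + 2 * (ε / 4 * τ) * ‖v‖ := by
      have : ‖v‖⁻¹ * (‖v + y‖ + ‖v - y‖) ≤ 2 + 2 * (ε / 4 * τ) := by linarith
      rw [inv_mul_le_iff₀ hn] at this
      linarith
    rw [sub_apply, hy]
    nlinarith
  have hk : 0 < τ * ‖v‖ := by positivity
  refine ContinuousLinearMap.opNorm_le_bound _ hε.le fun z => ?_
  rcases eq_or_ne z 0 with rfl | hz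
  · simp
  have hzn : 0 < ‖z‖ := norm_pos_iff.2 hz
  have s1 : ∀ z : X, z ≠ 0 → (f - f') z ≤ ε * ‖z‖ := by
    intro z hz
    have hzn : 0 < ‖z‖ := norm_pos_iff.2 hz
    have := key ((τ * ‖v‖ / ‖z‖) • z) (by
      rw [norm_smul, Real.norm_of_nonneg (by positivity)]; field_simp)
    rw [map_smul, norm_smul, Real.norm_of_nonneg (by positivity), smul_eq_mul] at this
    have hq : 0 < τ * ‖v‖ / ‖z‖ := by positivity
    nlinarith
  have t1 := s1 z hz
  have t2 := s1 (-z) (neg_ne_zero.2 hz)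
  rw [map_neg, norm_neg] at t2
  rw [sub_apply] at t1 t2
  rw [sub_apply, Real.norm_eq_abs, abs_le]
  constructor <;> linarith

theorem infD_le {A : Set X} {a : X} (ha : a ∈ A) (u : X) : infDist u A ≤ ‖a - u‖ := by
  rw [← dist_eq_norm, dist_comm]; exact infDist_le_dist_of_mem ha

theorem infD_lip (A : Set X) (u w : X) : infDist u A ≤ infDist w A + ‖u - w‖ := by
  rw [← dist_eq_norm]; exact infDist_le_infDist_add_dist

theorem infD_ex {A : Set X} (hne : A.Nonempty) (u : X) {η : ℝ} (hη : 0 < η) :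
    ∃ a ∈ A, ‖a - u‖ < infDist u A + η := by
  obtain ⟨a, ha, h⟩ := (infDist_lt_iff (x := u) hne).1 (lt_add_of_pos_right _ hη)
  exact ⟨a, ha, by rwa [← dist_eq_norm, dist_comm]⟩

def WPe (A : Set X) (ε : ℝ) (u : X) : Prop :=
  ∃ η > 0, ∀ a ∈ A, ∀ b ∈ A, ‖a - u‖ < infDist u A + η → ‖b - u‖ < infDist u A + η → ‖a - b‖ < ε

theorem WPe_isOpen (A : Set X) (ε : ℝ) : IsOpen {u | WPe A ε u} := by
  rw [Metric.isOpen_iff]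
  rintro u ⟨η, hη, h⟩
  refine ⟨η / 3, by positivity, fun w hw => ⟨η / 3, by positivity, fun a ha b hb h1 h2 => ?_⟩⟩
  rw [mem_ball, dist_eq_norm] at hw
  have k := infD_lip A w u
  have : ∀ c : X, ‖c - u‖ ≤ ‖c - w‖ + ‖w - u‖ := fun c => norm_sub_le_norm_sub_add_norm_sub _ _ _
  exact h a ha b hb (by linarith [this a]) (by linarith [this b])

theorem WPe_dense [UniformConvexSpace X] {A : Set X} (hA : IsClosed A) (hne : A.Nonempty)
    {ε : ℝ} (hε : 0 < ε) : Dense {u | WPe A ε u} := by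
  rw [Metric.dense_iff]
  intro u ρ hρ
  rcases (infDist_nonneg (x := u) (s := A)).eq_or_lt with h0 | hr
  · refine ⟨u, mem_ball_self hρ, ε / 2, by positivity, fun a _ b _ h1 h2 => ?_⟩
    rw [← h0] at h1 h2
    have := norm_sub_le_norm_sub_add_norm_sub a u b
    rw [norm_sub_rev u b] at this
    linarith
  set r := infDist u A with hrd
  obtain ⟨t, ht, ht1, htρ⟩ : ∃ t : ℝ, 0 < t ∧ t < 1 ∧ t * (r + 1) < ρ := by
    refine ⟨min (1 / 2) (ρ / (2 * (r + 1))), by positivity, ?_, ?_⟩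
    · exact (min_le_left _ _).trans_lt (by norm_num)
    · calc _ ≤ ρ / (2 * (r + 1)) * (r + 1) := by gcongr; exact min_le_right _ _
        _ = ρ / 2 := by field_simp
        _ < ρ := by linarith
  obtain ⟨η, hη, H⟩ := core (X := X) (α := (1 - t) * r) (β := t * r) (ε := ε)
    (mul_pos (by linarith) hr) (mul_pos ht hr) hε
  obtain ⟨a0, ha0, hd⟩ := infD_ex hne u (η := min 1 (η / 2)) (by positivity)
  rw [← hrd] at hd
  have m1 := min_le_left 1 (η / 2)
  have m2 := min_le_right 1 (η / 2)
  have e1 : (u + t • (a0 - u)) - u = t • (a0 - u) := by abel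
  have e2 : ‖(u + t • (a0 - u)) - u‖ = t * ‖a0 - u‖ := by
    rw [e1, norm_smul, Real.norm_of_nonneg ht.le]
  have e3 : a0 - (u + t • (a0 - u)) = (1 - t) • (a0 - u) := by module
  have e4 : ‖a0 - (u + t • (a0 - u))‖ = (1 - t) * ‖a0 - u‖ := by
    rw [e3, norm_smul, Real.norm_of_nonneg (by linarith)]
  set w := u + t • (a0 - u) with hw
  have hdw : infDist w A ≤ (1 - t) * ‖a0 - u‖ := e4 ▸ infD_le ha0 w
  have hdw' : (1 - t) * ‖a0 - u‖ ≤ (1 - t) * r + η / 2 := by nlinarith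
  refine ⟨w, ?_, η / 2, by positivity, fun a ha b hb h1 h2 => ?_⟩
  · rw [mem_ball, dist_eq_norm, e2]
    nlinarith
  · have hh : ∀ c ∈ A, (1 - t) * r + t * r - η ≤ ‖(c - w) + (w - u)‖ := by
      intro c hc
      rw [sub_add_sub_cancel]
      have := infD_le hc u
      linarith
    have := H (a - w) (b - w) (w - u) (by linarith) (by linarith) (by rw [e2]; nlinarith)
      (hh a ha) (hh b hb)
    rwa [sub_sub_sub_cancel_right] at this

theorem WP_exists [CompleteSpace X] {A : Set X} (hA : IsClosed A) (hne : A.Nonempty) {u : X}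
    (h : ∀ ε > 0, WPe A ε u) : ∃ x ∈ A, ‖x - u‖ = infDist u A := by
  choose a ha hd using fun n : ℕ => infD_ex hne u (η := 1 / ((n : ℝ) + 1)) (by positivity)
  have hlim : ∀ η > (0 : ℝ), ∃ N : ℕ, ∀ n ≥ N, ‖a n - u‖ < infDist u A + η := by
    intro η hη
    obtain ⟨N, hN⟩ := exists_nat_one_div_lt hη
    refine ⟨N, fun n hn => (hd n).trans_le ?_⟩
    have : 1 / ((n : ℝ) + 1) ≤ 1 / ((N : ℝ) + 1) := by gcongr
    linarith
  have hc : CauchySeq a := by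
    rw [Metric.cauchySeq_iff]
    intro ε hε
    obtain ⟨η, hη, H⟩ := h ε hε
    obtain ⟨N, hN⟩ := hlim η hη
    refine ⟨N, fun m hm n hn => ?_⟩
    rw [dist_eq_norm]
    exact H _ (ha m) _ (ha n) (hN m hm) (hN n hn)
  obtain ⟨x, hx⟩ := cauchySeq_tendsto_of_complete hc
  have hxA : x ∈ A := hA.mem_of_tendsto hx (Filter.Eventually.of_forall ha)
  refine ⟨x, hxA, le_antisymm ?_ (infD_le hxA u)⟩
  refine le_of_forall_pos_le_add fun η hη => ?_
  obtain ⟨N, hN⟩ := hlim η hη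
  have ht : Filter.Tendsto (fun n => ‖a n - u‖) Filter.atTop (nhds ‖x - u‖) :=
    (hx.sub_const u).norm
  exact le_of_tendsto ht (Filter.eventually_atTop.2 ⟨N, fun n hn => (hN n hn).le⟩)

theorem prox_dense [CompleteSpace X] [UniformConvexSpace X] {A : Set X} (hA : IsClosed A)
    (hne : A.Nonempty) (u : X) {ρ : ℝ} (hρ : 0 < ρ) :
    ∃ w, ‖w - u‖ < ρ ∧ ∃ x ∈ A, ‖x - w‖ = infDist w A := by
  have hD : Dense (⋂ n : ℕ, {u | WPe A (1 / ((n : ℝ) + 1)) u}) :=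
    dense_iInter_of_isOpen_nat (fun n => WPe_isOpen _ _)
      (fun n => WPe_dense hA hne (by positivity))
  obtain ⟨w, hw, hw2⟩ := Metric.dense_iff.1 hD u ρ hρ
  refine ⟨w, by rwa [← dist_eq_norm], WP_exists hA hne fun ε hε => ?_⟩
  obtain ⟨N, hN⟩ := exists_nat_one_div_lt hε
  obtain ⟨η, hη, H⟩ := Set.mem_iInter.1 hw2 N
  exact ⟨η, hη, fun a ha b hb h1 h2 => (H a ha b hb h1 h2).trans hN⟩

theorem WP_two [CompleteSpace X] {A : Set X} (hA : IsClosed A) (hne : A.Nonempty) {R : ℝ}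
    (h : ∀ u, 0 < infDist u A → infDist u A < R → ∀ ε > 0, WPe A ε u) :
    ∃ g : X → X, (∀ u : X, 0 < infDist u A → infDist u A < R → metricProj A u = {g u}) ∧
          ContinuousOn g {u : X | 0 < infDist u A ∧ infDist u A < R} := by
  have hex : ∀ u, ∃ x, 0 < infDist u A → infDist u A < R → x ∈ A ∧ ‖x - u‖ = infDist u A := by
    intro u
    by_cases hu : 0 < infDist u A ∧ infDist u A < R
    · obtain ⟨x, h1, h2⟩ := WP_exists hA hne (h u hu.1 hu.2)
      exact ⟨x, fun _ _ => ⟨h1, h2⟩⟩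
    · exact ⟨u, fun h1 h2 => (hu ⟨h1, h2⟩).elim⟩
  choose g hg using hex
  refine ⟨g, fun u h1 h2 => ?_, ?_⟩
  · ext y
    simp only [metricProj, Set.mem_setOf_eq, Set.mem_singleton_iff]
    constructor
    · rintro ⟨hy, hyd⟩
      rw [← sub_eq_zero, ← norm_eq_zero]
      refine le_antisymm (le_of_forall_pos_le_add fun ε hε => ?_) (norm_nonneg _)
      obtain ⟨η, hη, H⟩ := h u h1 h2 ε hε
      rw [zero_add]
      exact (H _ hy _ (hg u h1 h2).1 (by linarith) (by linarith [(hg u h1 h2).2])).le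
    · rintro rfl
      exact hg u h1 h2
  · rw [Metric.continuousOn_iff]
    rintro u ⟨h1, h2⟩ ε hε
    obtain ⟨η, hη, H⟩ := h u h1 h2 ε hε
    refine ⟨η / 2, by positivity, ?_⟩
    rintro w ⟨w1, w2⟩ hw
    rw [dist_eq_norm] at hw ⊢
    have k := infD_lip A w u
    have k2 := norm_sub_le_norm_sub_add_norm_sub (g w) w u
    exact H _ (hg w w1 w2).1 _ (hg u h1 h2).1 (by linarith [(hg w w1 w2).2])
      (by linarith [(hg u h1 h2).2])

/-- (3) implies well-posedness -/
theorem three_WP [CompleteSpace X] [UniformConvexSpace X] {A : Set X} (hA : IsClosed A)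
    (hne : A.Nonempty) {R : ℝ}
    (h3 : ∀ u : X, 0 < infDist u A → infDist u A < R →
          ∀ x ∈ metricProj A u, R ≤ infDist (x + (R / ‖u - x‖) • (u - x)) A)
    {u : X} (h1 : 0 < infDist u A) (h2 : infDist u A < R) {ε : ℝ} (hε : 0 < ε) : WPe A ε u := by
  set r := infDist u A with hr
  obtain ⟨η, hη, H⟩ := core (X := X) (α := r) (β := R - r) h1 (by linarith) hε
  obtain ⟨w, hw, x, hxA, hx⟩ := prox_dense hA hne u (ρ := min (η / 2) (min r (R - r)))
    (lt_min (by positivity) (lt_min h1 (by linarith)))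
  have w1 : ‖w - u‖ < η / 2 := hw.trans_le (min_le_left _ _)
  have w2 : ‖w - u‖ < r := hw.trans_le ((min_le_right _ _).trans (min_le_left _ _))
  have w3 : ‖w - u‖ < R - r := hw.trans_le ((min_le_right _ _).trans (min_le_right _ _))
  have k1 := infD_lip A w u
  have k2 := infD_lip A u w
  rw [norm_sub_rev u w] at k2
  have p1 : 0 < infDist w A := by linarith
  have p2 : infDist w A < R := by linarith
  have h := h3 w p1 p2 x ⟨hxA, hx⟩
  rw [norm_sub_rev x w] at hx
  rw [hx] at h
  set q := infDist w A with hq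
  set c := x + (R / q) • (w - x) with hc
  have ec : w - c = (-((R - q) / q)) • (w - x) := by
    have : (R - q) / q = R / q - 1 := by field_simp
    rw [hc, this]; module
  have nc : ‖w - c‖ = R - q := by
    rw [ec, norm_smul, norm_neg, Real.norm_of_nonneg (div_nonneg (by linarith) p1.le), hx]
    field_simp
  have nc2 : ‖u - c‖ ≤ R - r + η := by
    have := norm_sub_le_norm_sub_add_norm_sub u w c
    rw [norm_sub_rev u w] at this
    linarith
  have hh : ∀ b ∈ A, r + (R - r) - η ≤ ‖(b - u) + (u - c)‖ := by
    intro b hb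
    rw [sub_add_sub_cancel]
    linarith [infD_le hb c]
  refine ⟨η, hη, fun a ha b hb ha1 hb1 => ?_⟩
  have := H (a - u) (b - u) (u - c) ha1.le hb1.le nc2 (hh a ha) (hh b hb)
  rwa [sub_sub_sub_cancel_right] at this

/-- differentiability implies well-posedness -/
theorem diff_WP [UniformConvexSpace X] {A : Set X}
    {u : X} (h1 : 0 < infDist u A) (hd : DifferentiableAt ℝ (fun x => infDist x A) u)
    {ε : ℝ} (hε : 0 < ε) : WPe A ε u := by
  obtain ⟨p, hp⟩ := hd
  have hp1 : ‖p‖ ≤ 1 := by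
    simpa using hp.le_of_lipschitz (C := 1) (lipschitz_infDist_pt A)
  set r := infDist u A with hr
  obtain ⟨η, hη, H⟩ := core (X := X) (α := r) (β := r) h1 h1 hε
  have hκ : 0 < η / 4 / (r + 1) := by positivity
  obtain ⟨ρ, hρ, hb⟩ := Metric.eventually_nhds_iff.1
    ((hasFDerivAt_iff_isLittleO_nhds_zero.1 hp).def hκ)
  obtain ⟨t, ht, ht1, htρ⟩ : ∃ t : ℝ, 0 < t ∧ t < 1 ∧ t * (r + 1) < ρ := by
    refine ⟨min (1 / 2) (ρ / (2 * (r + 1))), by positivity, ?_, ?_⟩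
    · exact (min_le_left _ _).trans_lt (by norm_num)
    · calc _ ≤ ρ / (2 * (r + 1)) * (r + 1) := by gcongr; exact min_le_right _ _
        _ = ρ / 2 := by field_simp
        _ < ρ := by linarith
  have key : ∀ a ∈ A, ‖a - u‖ < r + min (min 1 η) (t * (η / 4)) → r - η / 2 ≤ p (u - a) := by
    intro a ha had
    have m1 : min (min 1 η) (t * (η / 4)) ≤ 1 := (min_le_left _ _).trans (min_le_left _ _)
    have m2 := min_le_right (min 1 η) (t * (η / 4))
    have n1 : ‖t • (a - u)‖ = t * ‖a - u‖ := by rw [norm_smul, Real.norm_of_nonneg ht.le]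
    have hin := hb (y := t • (a - u)) (by rw [dist_zero_right, n1]; nlinarith)
    rw [n1, Real.norm_eq_abs] at hin
    have hin2 := (abs_le.1 hin).1
    have e3 : a - (u + t • (a - u)) = (1 - t) • (a - u) := by module
    have hle := infD_le ha (u + t • (a - u))
    rw [e3, norm_smul, Real.norm_of_nonneg (by linarith)] at hle
    have e4 : p (t • (a - u)) = - (t * p (u - a)) := by
      rw [← neg_sub u a, smul_neg, map_neg, map_smul, smul_eq_mul]
    rw [e4] at hin2
    have q1 : η / 4 / (r + 1) * (t * ‖a - u‖) ≤ η / 4 * t := by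
      calc _ ≤ η / 4 / (r + 1) * (t * (r + 1)) := by gcongr; linarith
        _ = _ := by field_simp
    have q2 : (1 - t) * ‖a - u‖ ≤ (1 - t) * r + t * (η / 4) := by
      have : 0 < t * (η / 4) := by positivity
      nlinarith
    have q3 : t * (r - η / 2) ≤ t * p (u - a) := by nlinarith
    exact le_of_mul_le_mul_left q3 ht
  refine ⟨min (min 1 η) (t * (η / 4)), by positivity, fun a ha b hb' ha1 hb1 => ?_⟩
  have m3 : min (min 1 η) (t * (η / 4)) ≤ η := (min_le_left _ _).trans (min_le_right _ _)
  have ka := key a ha ha1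
  have kb := key b hb' hb1
  have hpn : ∀ z, p z ≤ ‖z‖ := fun z => (le_abs_self _).trans ((p.le_opNorm _).trans
      (mul_le_of_le_one_left (norm_nonneg _) hp1))
  have := H (u - a) (u - b) (u - b) (by rw [norm_sub_rev]; linarith)
    (by rw [norm_sub_rev]; linarith) (by rw [norm_sub_rev]; linarith)
    (le_trans (by rw [map_add]; linarith) (hpn _)) (le_trans (by rw [map_add]; linarith) (hpn _))
  rwa [sub_sub_sub_cancel_left, norm_sub_rev] at this

theorem U_isOpen (A : Set X) (R : ℝ) : IsOpen {u : X | 0 < infDist u A ∧ infDist u A < R} :=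
  (isOpen_lt continuous_const (continuous_infDist_pt A)).inter
    (isOpen_lt (continuous_infDist_pt A) continuous_const)

theorem two_one (hsm : UnifSmooth X) {A : Set X} (hA : IsClosed A) {R : ℝ} {g : X → X}
    (hg : ∀ u : X, 0 < infDist u A → infDist u A < R → metricProj A u = {g u})
    (hc : ContinuousOn g {u : X | 0 < infDist u A ∧ infDist u A < R}) :
    ProximallySmooth A R := by
  have hJ : ∀ v : X, ∃ f : X →L[ℝ] ℝ, ‖f‖ ≤ 1 ∧ f v = ‖v‖ := fun v => exists_dual_vector'' ℝ v
  choose J hJ1 hJ2 using hJ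
  have hJle : ∀ v z, J v z ≤ ‖z‖ := fun v z => (le_abs_self _).trans (((J v).le_opNorm _).trans
      (mul_le_of_le_one_left (norm_nonneg _) (hJ1 v)))
  have hgm : ∀ u ∈ {u : X | 0 < infDist u A ∧ infDist u A < R},
      g u ∈ A ∧ ‖u - g u‖ = infDist u A := by
    rintro u ⟨h1, h2⟩
    have : g u ∈ metricProj A u := by rw [hg u h1 h2]; rfl
    exact ⟨this.1, by rw [norm_sub_rev]; exact this.2⟩
  have hne : ∀ u ∈ {u : X | 0 < infDist u A ∧ infDist u A < R}, u - g u ≠ 0 := by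
    intro u hu
    rw [← norm_pos_iff, (hgm u hu).2]; exact hu.1
  have hder : ∀ u ∈ {u : X | 0 < infDist u A ∧ infDist u A < R},
      HasFDerivAt (fun x => infDist x A) (J (u - g u)) u := by
    intro u hu
    rw [hasFDerivAt_iff_isLittleO, Asymptotics.isLittleO_iff]
    intro ε hε
    obtain ⟨δ, hδ, H⟩ := duality_cont hsm (hne u hu) hε
    have hU := (U_isOpen A R).mem_nhds hu
    have hca := hc.continuousAt hU
    filter_upwards [hU, Metric.ball_mem_nhds u hδ, hca (Metric.ball_mem_nhds (g u) hδ)]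
      with w hwU hw hgw
    rw [Set.mem_preimage, mem_ball, dist_eq_norm] at hgw
    rw [mem_ball, dist_eq_norm] at hw
    have d1 := H (w - g u) (by rwa [sub_sub_sub_cancel_right]) (J (u - g u)) (J (w - g u))
      (hJ1 _) (hJ1 _) (hJ2 _) (hJ2 _)
    have d2 := H (u - g w) (by rwa [sub_sub_sub_cancel_left, norm_sub_rev]) (J (u - g u))
      (J (u - g w)) (hJ1 _) (hJ1 _) (hJ2 _) (hJ2 _)
    have b : ∀ f : X →L[ℝ] ℝ, ‖f‖ ≤ ε → |f (w - u)| ≤ ε * ‖w - u‖ := fun f hf =>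
      (f.le_opNorm _).trans (by gcongr)
    have b1 := abs_le.1 (b _ d1)
    have b2 := abs_le.1 (b _ d2)
    rw [sub_apply] at b1 b2
    have u1 : infDist w A ≤ ‖w - g u‖ := by
      rw [norm_sub_rev]; exact infD_le (hgm u hu).1 w
    have u2 := hJle (w - g u) (u - g u)
    have u3 : J (w - g u) (u - g u) = ‖w - g u‖ - J (w - g u) (w - u) := by
      rw [← hJ2 (w - g u), ← map_sub]; congr 1; abel
    have l1 : infDist u A ≤ ‖u - g w‖ := by
      rw [norm_sub_rev]; exact infD_le (hgm w hwU).1 u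
    have l2 := hJle (u - g w) (w - g w)
    have l3 : J (u - g w) (w - g w) = ‖u - g w‖ + J (u - g w) (w - u) := by
      rw [← hJ2 (u - g w), ← map_add]; congr 1; abel
    have g1 := (hgm u hu).2
    have g2 := (hgm w hwU).2
    rw [Real.norm_eq_abs, abs_le]
    constructor <;> linarith
  refine ⟨hA, ?_⟩
  rw [show (1 : WithTop ℕ∞) = 0 + 1 by simp, contDiffOn_succ_iff_fderiv_of_isOpen (U_isOpen A R)]
  refine ⟨fun u hu => (hder u hu).differentiableAt.differentiableWithinAt, by simp, ?_⟩
  rw [contDiffOn_zero]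
  have : ContinuousOn (fun u => J (u - g u)) {u : X | 0 < infDist u A ∧ infDist u A < R} := by
    rw [Metric.continuousOn_iff]
    intro u hu ε hε
    obtain ⟨δ, hδ, H⟩ := duality_cont hsm (hne u hu) (half_pos hε)
    have hcc : ContinuousOn (fun u => u - g u) {u : X | 0 < infDist u A ∧ infDist u A < R} :=
      continuousOn_id.sub hc
    obtain ⟨ρ, hρ, hh⟩ := Metric.continuousOn_iff.1 hcc u hu δ hδ
    refine ⟨ρ, hρ, fun w hw hwu => ?_⟩
    have h1 := hh w hw hwu
    rw [dist_eq_norm] at h1 ⊢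
    have := H _ h1 (J (u - g u)) (J (w - g w)) (hJ1 _) (hJ1 _) (hJ2 _) (hJ2 _)
    linarith
  exact this.congr fun u hu => (hder u hu).fderiv

theorem ekeland_aux [CompleteSpace X] {f : X → ℝ} (hf : Continuous f) {K : Set X}
    (hK : IsClosed K) {M : ℝ} (hM : ∀ z ∈ K, f z ≤ M) {l : ℝ} (hl : 0 < l) {u : X} (hu : u ∈ K) :
    ∃ w ∈ K, f u + l * ‖w - u‖ ≤ f w ∧ ∀ z ∈ K, f w + l * ‖z - w‖ ≤ f z → z = w := by
  have step : ∀ (n : ℕ) (w : X), ∃ w', w ∈ K → (w' ∈ K ∧ f w + l * ‖w' - w‖ ≤ f w' ∧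
      ∀ z ∈ K, f w + l * ‖z - w‖ ≤ f z → f z ≤ f w' + (1 / 2 : ℝ) ^ n) := by
    intro n w
    by_cases hw : w ∈ K
    swap
    · exact ⟨w, fun h => (hw h).elim⟩
    set S := {z | z ∈ K ∧ f w + l * ‖z - w‖ ≤ f z} with hS
    have hSne : (f '' S).Nonempty := ⟨f w, w, ⟨hw, by simp⟩, rfl⟩
    have hbd : BddAbove (f '' S) := ⟨M, by rintro _ ⟨z, hz, rfl⟩; exact hM z hz.1⟩
    obtain ⟨_, ⟨w', hw', rfl⟩, hlt⟩ := exists_lt_of_lt_csSup hSne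
      (sub_lt_self (sSup (f '' S)) (show (0 : ℝ) < (1 / 2) ^ n by positivity))
    refine ⟨w', fun _ => ⟨hw'.1, hw'.2, fun z hz hz2 => ?_⟩⟩
    have := le_csSup hbd (Set.mem_image_of_mem f (show z ∈ S from ⟨hz, hz2⟩))
    linarith
  choose F hF using step
  let w : ℕ → X := fun n => Nat.rec u (fun n x => F n x) n
  have w0 : w 0 = u := rfl
  have ws : ∀ n, w (n + 1) = F n (w n) := fun n => rfl
  have wK : ∀ n, w n ∈ K := by
    intro n
    induction n with
    | zero => exact hu
    | succ n ih => rw [ws]; exact (hF n _ ih).1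
  have trans : ∀ a b c : X, f a + l * ‖b - a‖ ≤ f b → f b + l * ‖c - b‖ ≤ f c →
      f a + l * ‖c - a‖ ≤ f c := by
    intro a b c h1 h2
    have := norm_sub_le_norm_sub_add_norm_sub c b a
    nlinarith
  have mono : ∀ n m, n ≤ m → f (w n) + l * ‖w m - w n‖ ≤ f (w m) := by
    intro n m h
    induction m, h using Nat.le_induction with
    | base => simp
    | succ m _ ih =>
      refine trans _ _ _ ih ?_
      rw [ws]; exact (hF m _ (wK m)).2.1
  have small : ∀ n, ∀ z ∈ K, f (w (n + 1)) + l * ‖z - w (n + 1)‖ ≤ f z →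
      ‖z - w (n + 1)‖ ≤ (1 / 2) ^ n / l := by
    intro n z hz h
    have h1 := (hF n _ (wK n)).2.2 z hz (trans _ _ _ (mono n (n + 1) (Nat.le_succ n)) h)
    rw [← ws] at h1
    rw [le_div_iff₀ hl]
    linarith
  have hb : Filter.Tendsto (fun n : ℕ => (1 / 2 : ℝ) ^ n / l) Filter.atTop (nhds 0) := by
    have := (tendsto_pow_atTop_nhds_zero_of_lt_one (r := (1 / 2 : ℝ)) (by norm_num)
      (by norm_num)).div_const l
    simpa using this
  have hcau : CauchySeq (fun n => w (n + 1)) := by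
    refine cauchySeq_of_le_tendsto_0' (fun n : ℕ => (1 / 2 : ℝ) ^ n / l) (fun n m h => ?_) hb
    rw [dist_comm, dist_eq_norm]
    exact small n (w (m + 1)) (wK (m + 1)) (mono (n + 1) (m + 1) (by omega))
  obtain ⟨x, hx⟩ := cauchySeq_tendsto_of_complete hcau
  have hxK : x ∈ K := hK.mem_of_tendsto hx (Filter.Eventually.of_forall fun n => wK (n + 1))
  have hxn : ∀ n, f (w n) + l * ‖x - w n‖ ≤ f x := by
    intro n
    refine le_of_tendsto_of_tendsto (((hx.sub_const (w n)).norm.const_mul l).const_add (f (w n)))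
      ((hf.tendsto x).comp hx) (Filter.eventually_atTop.2 ⟨n, fun m hm => mono n (m + 1) (by omega)⟩)
  refine ⟨x, hxK, w0 ▸ hxn 0, fun z hz h => ?_⟩
  have hz2 : Filter.Tendsto (fun n => w (n + 1)) Filter.atTop (nhds z) := by
    rw [tendsto_iff_norm_sub_tendsto_zero]
    refine squeeze_zero (fun _ => norm_nonneg _) (fun n => ?_) hb
    rw [norm_sub_rev]
    exact small n z hz (trans _ _ _ (hxn (n + 1)) h)
  exact tendsto_nhds_unique hz2 hx

theorem growth [CompleteSpace X] [UniformConvexSpace X] {A : Set X} (hA : IsClosed A)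
    (hne : A.Nonempty) {R : ℝ}
    (hd : ∀ u, 0 < infDist u A → infDist u A < R → DifferentiableAt ℝ (fun x => infDist x A) u)
    {u : X} {τ : ℝ} (hτ : 0 < τ) (h1 : τ < infDist u A) (h2 : infDist u A + τ < R)
    {l : ℝ} (hl : 0 < l) (hl1 : l < 1) :
    ∃ w, ‖w - u‖ ≤ τ ∧ infDist u A + l * τ ≤ infDist w A := by
  obtain ⟨w, hwK, hw1, hw2⟩ := ekeland_aux (f := fun x => infDist x A) (continuous_infDist_pt A)
    (K := closedBall u τ) isClosed_closedBall (M := infDist u A + τ)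
    (fun z hz => by
      rw [mem_closedBall, dist_eq_norm] at hz
      linarith [infD_lip A z u]) hl (mem_closedBall_self hτ.le)
  rw [mem_closedBall, dist_eq_norm] at hwK
  refine ⟨w, hwK, ?_⟩
  rcases hwK.eq_or_lt with h | h
  · rw [← h]; exact hw1
  exfalso
  have k1 := infD_lip A w u
  have k2 := infD_lip A u w
  rw [norm_sub_rev] at k2
  have p1 : 0 < infDist w A := by linarith
  have hdw := hd w p1 (by linarith)
  obtain ⟨x, hxA, hx⟩ := WP_exists hA hne (fun ε hε => diff_WP p1 hdw hε)
  obtain ⟨p, hp⟩ := hdw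
  set r := infDist w A with hr
  have hκ : 0 < (1 - l) / 4 := by linarith
  obtain ⟨ρ, hρ, hb⟩ := Metric.eventually_nhds_iff.1
    ((hasFDerivAt_iff_isLittleO_nhds_zero.1 hp).def hκ)
  obtain ⟨t, ht, ht1, htρ, htτ⟩ : ∃ t : ℝ, 0 < t ∧ t < 1 ∧ t * r < ρ ∧ t * r < τ - ‖w - u‖ := by
    have hm : 0 < min ρ (τ - ‖w - u‖) := lt_min hρ (by linarith)
    have hq : min (1 / 2) (min ρ (τ - ‖w - u‖) / (2 * r)) * r < min ρ (τ - ‖w - u‖) := by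
      calc _ ≤ min ρ (τ - ‖w - u‖) / (2 * r) * r := by gcongr; exact min_le_right _ _
        _ = min ρ (τ - ‖w - u‖) / 2 := by field_simp
        _ < _ := by linarith
    refine ⟨min (1 / 2) (min ρ (τ - ‖w - u‖) / (2 * r)), by positivity, ?_, ?_, ?_⟩
    · exact (min_le_left _ _).trans_lt (by norm_num)
    · exact hq.trans_le (min_le_left _ _)
    · exact hq.trans_le (min_le_right _ _)
  have n1 : ‖t • (x - w)‖ = t * r := by rw [norm_smul, Real.norm_of_nonneg ht.le, hx]
  have n2 : ‖-(t • (x - w))‖ = t * r := by rw [norm_neg, n1]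
  have i1 := hb (y := t • (x - w)) (by rw [dist_zero_right, n1]; exact htρ)
  have i2 := hb (y := -(t • (x - w))) (by rw [dist_zero_right, n2]; exact htρ)
  rw [n1, Real.norm_eq_abs] at i1
  rw [n2, Real.norm_eq_abs, map_neg] at i2
  have j1 := (abs_le.1 i1).1
  have j2 := (abs_le.1 i2).1
  have e3 : x - (w + t • (x - w)) = (1 - t) • (x - w) := by module
  have hle := infD_le hxA (w + t • (x - w))
  rw [e3, norm_smul, Real.norm_of_nonneg (by linarith), hx] at hle
  have htr : 0 < t * r := by positivity
  have hzz := hw2 (w + -(t • (x - w))) (by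
      rw [mem_closedBall, dist_eq_norm, add_sub_right_comm]
      refine (norm_add_le _ _).trans ?_
      rw [n2]; linarith) (by
      rw [add_sub_cancel_left, n2]
      nlinarith)
  rw [add_eq_left] at hzz
  rw [hzz, norm_zero] at n2
  linarith

theorem one_three [CompleteSpace X] [UniformConvexSpace X] {A : Set X} (hA : IsClosed A)
    {R : ℝ}
    (hd : ∀ u, 0 < infDist u A → infDist u A < R → DifferentiableAt ℝ (fun x => infDist x A) u)
    {u : X} (h1 : 0 < infDist u A) (h2 : infDist u A < R) {x : X} (hx : x ∈ metricProj A u) :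
    R ≤ infDist (x + (R / ‖u - x‖) • (u - x)) A := by
  obtain ⟨hxA, hxu⟩ := hx
  have hne : A.Nonempty := ⟨x, hxA⟩
  rw [norm_sub_rev] at hxu
  rw [hxu]
  set r := infDist u A with hr
  set v := r⁻¹ • (u - x) with hv
  have nv : ‖v‖ = 1 := by
    rw [hv, norm_smul, hxu, norm_inv, Real.norm_of_nonneg h1.le, inv_mul_cancel₀ h1.ne']
  have e1 : (R / r) • (u - x) = R • v := by rw [hv, smul_smul, div_eq_mul_inv]
  rw [e1]
  have hle : ∀ s, 0 ≤ s → infDist (x + s • v) A ≤ s := by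
    intro s hs
    have := infD_le hxA (x + s • v)
    rwa [norm_sub_rev, add_sub_cancel_left, norm_smul, nv, mul_one, Real.norm_of_nonneg hs] at this
  have hcont : Continuous fun s : ℝ => infDist (x + s • v) A :=
    (continuous_infDist_pt A).comp (by fun_prop)
  have main : Set.Icc r R ⊆ {s : ℝ | s ≤ infDist (x + s • v) A} := by
    apply IsClosed.Icc_subset_of_forall_exists_gt
    · exact (isClosed_le continuous_id hcont).inter isClosed_Icc
    · have : x + r • v = u := by
        rw [hv, smul_smul, mul_inv_cancel₀ h1.ne', one_smul, add_sub_cancel]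
      simp only [Set.mem_setOf_eq, this]
      exact le_rfl
    rintro s ⟨hs, hs1, hs2⟩ y hy
    rw [Set.mem_setOf_eq] at hs
    rw [Set.mem_Ioi] at hy
    have s0 : 0 < s := h1.trans_le hs1
    have hse : infDist (x + s • v) A = s := le_antisymm (hle s s0.le) hs
    obtain ⟨τ, hτ, t1, t2, t3⟩ : ∃ τ > 0, τ < s ∧ s + τ < R ∧ s + τ ≤ y := by
      have hm : 0 < min s (min (R - s) (y - s)) :=
        lt_min s0 (lt_min (by linarith) (by linarith))
      have q1 : min s (min (R - s) (y - s)) ≤ s := min_le_left _ _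
      have q2 : min s (min (R - s) (y - s)) ≤ R - s := (min_le_right _ _).trans (min_le_left _ _)
      have q3 : min s (min (R - s) (y - s)) ≤ y - s := (min_le_right _ _).trans (min_le_right _ _)
      exact ⟨min s (min (R - s) (y - s)) / 2, by positivity, by linarith, by linarith,
        by linarith⟩
    refine ⟨s + τ, ?_, by linarith, t3⟩
    rw [Set.mem_setOf_eq]
    refine le_of_forall_pos_le_add fun ε hε => ?_
    obtain ⟨η, hη, H⟩ := core (X := X) hτ s0 (half_pos hε)
    obtain ⟨l, hl0, hl1, hl2⟩ : ∃ l : ℝ, 0 < l ∧ l < 1 ∧ τ - min η (ε / 2) ≤ l * τ := by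
      have hm : 0 < min η (ε / 2) := by positivity
      refine ⟨max (1 / 2) (1 - min η (ε / 2) / τ), by positivity, ?_, ?_⟩
      · refine max_lt (by norm_num) ?_
        have : 0 < min η (ε / 2) / τ := by positivity
        linarith
      · calc _ = (1 - min η (ε / 2) / τ) * τ := by field_simp
          _ ≤ _ := by gcongr; exact le_max_right _ _
    have m1 := min_le_left η (ε / 2)
    have m2 := min_le_right η (ε / 2)
    obtain ⟨w, hw1, hw2⟩ := growth hA hne hd (u := x + s • v) hτ (by rw [hse]; exact t1)
      (by rw [hse]; exact t2) hl0 hl1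
    rw [hse] at hw2
    have hwx := infD_le hxA w
    rw [norm_sub_rev] at hwx
    have nτ : ‖τ • v‖ = τ := by rw [norm_smul, nv, mul_one, Real.norm_of_nonneg hτ.le]
    have ns : ‖s • v‖ = s := by rw [norm_smul, nv, mul_one, Real.norm_of_nonneg s0.le]
    have nsum : ‖τ • v + s • v‖ = τ + s := by
      rw [← add_smul, norm_smul, nv, mul_one, Real.norm_of_nonneg (by linarith)]
    have ee : w - (x + s • v) + s • v = w - x := by abel
    have fin := H (w - (x + s • v)) (τ • v) (s • v) (by linarith) (by linarith) (by linarith)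
      (by rw [ee]; linarith) (by linarith)
    have e5 : w - (x + s • v) - τ • v = w - (x + (s + τ) • v) := by module
    rw [e5] at fin
    have := infD_lip A w (x + (s + τ) • v)
    linarith
  exact main ⟨h2.le, le_rfl⟩

end helpers

theorem statement2 (X : Type*) [NormedAddCommGroup X] [NormedSpace ℝ X]
    [CompleteSpace X] [UniformConvexSpace X] (hsm : UnifSmooth X)
    (A : Set X) (hA : IsClosed A) (R : ℝ) (hR : 0 < R) :
    List.TFAE
      [ ProximallySmooth A R,
        ∃ g : X → X,
          (∀ u : X, 0 < Metric.infDist u A → Metric.infDist u A < R →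
            metricProj A u = {g u}) ∧
          ContinuousOn g {u : X | 0 < Metric.infDist u A ∧ Metric.infDist u A < R},
        ∀ u : X, 0 < Metric.infDist u A → Metric.infDist u A < R →
          ∀ x ∈ metricProj A u,
            R ≤ Metric.infDist (x + (R / ‖u - x‖) • (u - x)) A ] := by
  rcases A.eq_empty_or_nonempty with rfl | hne
  · have h1 : ProximallySmooth (∅ : Set X) R := by
      refine ⟨hA, ?_⟩
      intro x hx
      simp at hx
    have h2 : ∃ g : X → X,
          (∀ u : X, 0 < Metric.infDist u (∅ : Set X) → Metric.infDist u (∅ : Set X) < R →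
            metricProj (∅ : Set X) u = {g u}) ∧
          ContinuousOn g {u : X | 0 < Metric.infDist u (∅ : Set X) ∧
            Metric.infDist u (∅ : Set X) < R} :=
      ⟨id, fun u hu => by simp at hu, continuousOn_id⟩
    have h3 : ∀ u : X, 0 < Metric.infDist u (∅ : Set X) → Metric.infDist u (∅ : Set X) < R →
          ∀ x ∈ metricProj (∅ : Set X) u,
            R ≤ Metric.infDist (x + (R / ‖u - x‖) • (u - x)) (∅ : Set X) :=
      fun u hu => by simp at hu
    tfae_have 1 → 2 := fun _ => h2
    tfae_have 2 → 3 := fun _ => h3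
    tfae_have 3 → 1 := fun _ => h1
    tfae_finish
  have hdiff : ProximallySmooth A R → ∀ u, 0 < infDist u A → infDist u A < R →
      DifferentiableAt ℝ (fun x => infDist x A) u := by
    rintro ⟨_, h⟩ u h1 h2
    exact (h.differentiableOn one_ne_zero).differentiableAt ((U_isOpen A R).mem_nhds ⟨h1, h2⟩)
  tfae_have 1 → 3 := fun h u h1 h2 x hx => one_three hA (hdiff h) h1 h2 hx
  tfae_have 3 → 2 := fun h => WP_two hA hne fun u h1 h2 ε hε => three_WP hA hne h h1 h2 hε
  tfae_have 2 → 1 := by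
    rintro ⟨g, hg, hc⟩
    exact two_one hsm hA hg hc
  tfae_finish
end
end

section
/- Let X be a uniformly convex and uniformly smooth real Banach space, let R > 0, and let A ⊂ X be a set that is proximally smooth with constant R. Let x0, x1 ∈ A satisfy ‖x0 − x1‖/R < 2 and let λ ∈ [0, 1]. Then the point x_λ = (1 − λ)x0 + λx1 satisfies dist(x_λ, A) ≤ 8R·λ(1 − λ)·ρ_X(‖x0 − x1‖/R). -/
noncomputable section

open Set Metric

lemma aux_rho {X : Type*} [NormedAddCommGroup X] [NormedSpace ℝ X] (u y : X) (hu : ‖u‖ = 1) :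
    (‖u + y‖ + ‖u - y‖) / 2 - 1 ≤ modSmooth X ‖y‖ := by
  apply le_csSup
  · refine ⟨‖y‖, ?_⟩
    rintro r ⟨a, b, ha, hb, rfl⟩
    have := norm_add_le a b
    have := norm_sub_le a b
    linarith
  · exact ⟨u, y, hu, rfl, rfl⟩

lemma aux_stuff {X : Type*} [NormedAddCommGroup X] [NormedSpace ℝ X] (u y : X) (hu : ‖u‖ = 1)
    (l : ℝ) (h0 : 0 ≤ l) (h1 : l ≤ 1) :
    (1 - l) * ‖u - l • y‖ + l * ‖u + (1 - l) • y‖ ≤ 1 + 2 * (l * (1 - l)) * modSmooth X ‖y‖ := by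
  have e1 : ‖u - l • y‖ ≤ (1 - l) + l * ‖u - y‖ := by
    have : u - l • y = (1 - l) • u + l • (u - y) := by module
    rw [this]
    refine (norm_add_le _ _).trans ?_
    rw [norm_smul, norm_smul, hu, Real.norm_of_nonneg h0, Real.norm_of_nonneg (by linarith)]
    linarith
  have e2 : ‖u + (1 - l) • y‖ ≤ l + (1 - l) * ‖u + y‖ := by
    have : u + (1 - l) • y = l • u + (1 - l) • (u + y) := by module
    rw [this]
    refine (norm_add_le _ _).trans ?_
    rw [norm_smul, norm_smul, hu, Real.norm_of_nonneg h0,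
      Real.norm_of_nonneg (show 0 ≤ 1 - l by linarith)]
    linarith
  have e3 := aux_rho u y hu
  have hl : 0 ≤ l * (1 - l) := mul_nonneg h0 (by linarith)
  have f1 := mul_le_mul_of_nonneg_left e1 (show 0 ≤ 1 - l by linarith)
  have f2 := mul_le_mul_of_nonneg_left e2 h0
  have f3 := mul_le_mul_of_nonneg_left e3 hl
  nlinarith

/-- Ekeland-type maximal element. -/
lemma aux_ekeland {X : Type*} [NormedAddCommGroup X] [CompleteSpace X] (f : X → ℝ)
    (hf : Continuous f) (S : Set X) (hS : IsClosed S) (M : ℝ) (hM : ∀ x ∈ S, f x ≤ M)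
    (η : ℝ) (hη : 0 < η) (x : X) (hx : x ∈ S) :
    ∃ z ∈ S, η * ‖z - x‖ ≤ f z - f x ∧ ∀ y ∈ S, η * ‖y - z‖ ≤ f y - f z → y = z := by
  let T : X → Set X := fun z => {y | y ∈ S ∧ η * ‖y - z‖ ≤ f y - f z}
  have hTtrans : ∀ a b c, b ∈ T a → c ∈ T b → c ∈ T a := by
    rintro a b c ⟨_, h1⟩ ⟨h2, h3⟩
    refine ⟨h2, ?_⟩
    have : ‖c - a‖ ≤ ‖c - b‖ + ‖b - a‖ := norm_sub_le_norm_sub_add_norm_sub c b a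
    nlinarith
  have hself : ∀ a ∈ S, a ∈ T a := fun a ha => ⟨ha, by simp⟩
  have hbd : ∀ a, BddAbove (f '' T a) := by
    intro a
    refine ⟨M, ?_⟩
    rintro _ ⟨y, hy, rfl⟩
    exact hM y hy.1
  have step : ∀ a : S, ∃ b : S, (b : X) ∈ T a ∧ (f a + sSup (f '' T a)) / 2 ≤ f b := by
    rintro ⟨a, ha⟩
    have hle : f a ≤ sSup (f '' T a) := le_csSup (hbd a) ⟨a, hself a ha, rfl⟩
    rcases hle.eq_or_lt with h | h
    · exact ⟨⟨a, ha⟩, hself a ha, by simp only; linarith⟩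
    · have : (f a + sSup (f '' T a)) / 2 < sSup (f '' T a) := by linarith
      obtain ⟨_, ⟨b, hb, rfl⟩, hb'⟩ := exists_lt_of_lt_csSup
        (show (f '' T a).Nonempty from ⟨f a, a, hself a ha, rfl⟩) this
      exact ⟨⟨b, hb.1⟩, hb, hb'.le⟩
  choose g hg1 hg2 using step
  let z : ℕ → S := fun n => g^[n] ⟨x, hx⟩
  have hzs : ∀ n, z (n + 1) = g (z n) := fun n => Function.iterate_succ_apply' g n _
  have hz1 : ∀ n, (z (n + 1) : X) ∈ T (z n) := fun n => by rw [hzs]; exact hg1 _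
  have hz2 : ∀ n, (f (z n) + sSup (f '' T (z n))) / 2 ≤ f (z (n + 1)) := fun n => by
    rw [hzs]; exact hg2 _
  have hchain : ∀ n m, n ≤ m → (z m : X) ∈ T (z n) := by
    intro n m h
    induction m, h using Nat.le_induction with
    | base => exact hself _ (z n).2
    | succ m _ ih => exact hTtrans _ _ _ ih (hz1 m)
  have hmono : Monotone (fun n => f (z n)) := by
    intro n m h
    have := (hchain n m h).2
    have : 0 ≤ η * ‖(z m : X) - z n‖ := by positivity
    simp only
    linarith
  have hconv := tendsto_atTop_ciSup hmono ⟨M, by rintro _ ⟨n, rfl⟩; exact hM _ (z n).2⟩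
  have hcau0 := hconv.cauchySeq
  have hcau : CauchySeq (fun n => (z n : X)) := by
    rw [Metric.cauchySeq_iff'] at hcau0 ⊢
    intro ε hε
    obtain ⟨N, hN⟩ := hcau0 (η * ε) (by positivity)
    refine ⟨N, fun n hn => ?_⟩
    have h1 := hN n hn
    have h2 := (hchain N n hn).2
    rw [Real.dist_eq] at h1
    have h3 := (abs_lt.mp h1).2
    rw [dist_eq_norm]
    exact lt_of_mul_lt_mul_left (h2.trans_lt h3) hη.le
  obtain ⟨w, hw⟩ := cauchySeq_tendsto_of_complete hcau
  have hfw : Filter.Tendsto (fun n => f (z n)) Filter.atTop (nhds (f w)) :=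
    (hf.tendsto w).comp hw
  have hTclosed : ∀ a, IsClosed (T a) := by
    intro a
    have h1 : Continuous (fun y => η * ‖y - a‖) := by fun_prop
    have h2 : Continuous (fun y => f y - f a) := by fun_prop
    exact hS.inter (isClosed_le h1 h2)
  have hwT : ∀ n, w ∈ T (z n) := by
    intro n
    refine (hTclosed _).mem_of_tendsto hw ?_
    filter_upwards [Filter.eventually_ge_atTop n] with m hm using hchain n m hm
  refine ⟨w, (hwT 0).1, (hwT 0).2, ?_⟩
  intro y hyS hy
  have hyT : ∀ n, y ∈ T (z n) := fun n => hTtrans _ _ _ (hwT n) ⟨hyS, hy⟩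
  have hle : f y ≤ f w := by
    have h1 : ∀ n, f y ≤ 2 * f (z (n + 1)) - f (z n) := by
      intro n
      have := hz2 n
      have h3 : f y ≤ sSup (f '' T (z n)) := le_csSup (hbd _) ⟨y, hyT n, rfl⟩
      linarith
    have h2 : Filter.Tendsto (fun n => 2 * f (z (n + 1)) - f (z n)) Filter.atTop
        (nhds (2 * f w - f w)) :=
      ((hfw.comp (Filter.tendsto_add_atTop_nat 1)).const_mul 2).sub hfw
    have := ge_of_tendsto' h2 h1
    linarith
  have : ‖y - w‖ ≤ 0 := by
    by_contra h
    push Not at h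
    have := mul_pos hη h
    linarith
  exact sub_eq_zero.mp (norm_le_zero_iff.mp this)

lemma aux_grad {X : Type*} [NormedAddCommGroup X] [NormedSpace ℝ X]
    (A : Set X) (hne : A.Nonempty) (z : X) (hz : 0 < infDist z A)
    (hd : DifferentiableAt ℝ (fun x => infDist x A) z) :
    1 ≤ ‖fderiv ℝ (fun x => infDist x A) z‖ := by
  set L := fderiv ℝ (fun x => infDist x A) z with hL
  have hfd := hd.hasFDerivAt
  rw [← hL] at hfd
  refine le_of_forall_pos_le_add fun ε hε => ?_
  have h1 := (hasFDerivAt_iff_isLittleO_nhds_zero.mp hfd).def (half_pos hε)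
  obtain ⟨r, hr, hball⟩ := Metric.eventually_nhds_iff.mp h1
  let t := min (r / 2) (infDist z A)
  have ht : 0 < t := lt_min (by linarith) hz
  have htr : t < r := (min_le_left _ _).trans_lt (by linarith)
  have htd : t ≤ infDist z A := min_le_right _ _
  obtain ⟨a, ha, haz⟩ := (infDist_lt_iff hne).mp
    (show infDist z A < infDist z A + t * (ε / 2) by linarith [mul_pos ht (half_pos hε)])
  have hza := infDist_le_dist_of_mem (x := z) ha
  have hD : 0 < dist z a := hz.trans_le hza
  let h : X := (t / dist z a) • (a - z)
  have hn : ‖h‖ = t := by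
    simp only [h]
    rw [norm_smul, Real.norm_of_nonneg (by positivity), ← dist_eq_norm, dist_comm a z]
    field_simp
  have hb := hball (y := h) (by rw [dist_zero_right, hn]; exact htr)
  have hdist : infDist (z + h) A ≤ dist z a - t := by
    refine (infDist_le_dist_of_mem ha).trans ?_
    have e : z + h - a = (1 - t / dist z a) • (z - a) := by simp only [h]; module
    have : t / dist z a ≤ 1 := by rw [div_le_one hD]; linarith
    rw [dist_eq_norm, e, norm_smul, Real.norm_of_nonneg (by linarith), ← dist_eq_norm]
    apply le_of_eq
    field_simp
  rw [hn, Real.norm_eq_abs] at hb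
  have hb' := (abs_le.mp hb).1
  have hLh : |L h| ≤ ‖L‖ * t := by
    have := L.le_opNorm h
    rwa [hn] at this
  have := (abs_le.mp hLh).1
  have : t * 1 ≤ t * (‖L‖ + ε) := by linarith
  exact le_of_mul_le_mul_left this ht

lemma aux_ascent_s3 {X : Type*} [NormedAddCommGroup X] [NormedSpace ℝ X] (f : X → ℝ) (z : X)
    (hd : DifferentiableAt ℝ f z) (hL : 1 ≤ ‖fderiv ℝ f z‖) (η : ℝ) (h0 : 0 < η) (h1 : η < 1)
    (δ : ℝ) (hδ : 0 < δ) : ∃ y, y ≠ z ∧ ‖y - z‖ < δ ∧ η * ‖y - z‖ ≤ f y - f z := by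
  set L := fderiv ℝ f z with hLd
  have hfd := hd.hasFDerivAt
  rw [← hLd] at hfd
  let κ := (η + 1) / 2
  have hκ : κ < ‖L‖ := by simp only [κ]; linarith
  obtain ⟨v, hv1, hv2⟩ : ∃ v, ‖v‖ = 1 ∧ κ < L v := by
    by_contra hcon
    push Not at hcon
    apply absurd hκ
    push Not
    refine L.opNorm_le_of_unit_norm (by simp only [κ]; linarith) ?_
    intro v hv
    rw [Real.norm_eq_abs, abs_le]
    have e1 := hcon v hv
    have e2 := hcon (-v) (by rwa [norm_neg])
    rw [map_neg] at e2
    exact ⟨by linarith, e1⟩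
  have hh := (hasFDerivAt_iff_isLittleO_nhds_zero.mp hfd).def (show 0 < (1 - η) / 2 by linarith)
  obtain ⟨r, hr, hball⟩ := Metric.eventually_nhds_iff.mp hh
  let t := min (r / 2) (δ / 2)
  have ht : 0 < t := lt_min (by linarith) (by linarith)
  have htr : t < r := (min_le_left _ _).trans_lt (by linarith)
  have htd : t < δ := (min_le_right _ _).trans_lt (by linarith)
  have hn : ‖t • v‖ = t := by rw [norm_smul, hv1, Real.norm_of_nonneg ht.le, mul_one]
  have hb := hball (y := t • v) (by rw [dist_zero_right, hn]; exact htr)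
  rw [hn, Real.norm_eq_abs, map_smul, smul_eq_mul] at hb
  have hb' := (abs_le.mp hb).1
  have hm := mul_lt_mul_of_pos_left hv2 ht
  refine ⟨z + t • v, ?_, ?_, ?_⟩
  · intro h
    have : t • v = 0 := by simpa using h
    rw [this, norm_zero] at hn
    linarith
  · simpa [hn] using htd
  · rw [add_sub_cancel_left, hn]
    simp only [κ] at hm
    linarith

lemma aux_reach {X : Type*} [NormedAddCommGroup X] [NormedSpace ℝ X] [CompleteSpace X]
    (A : Set X) (hne : A.Nonempty) (R : ℝ) (hA : ProximallySmooth A R)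
    (x : X) (hx0 : 0 < infDist x A) (R1 : ℝ) (hx1 : infDist x A < R1) (hR1 : R1 < R) :
    ∃ c, ‖c - x‖ ≤ R - infDist x A ∧ R1 ≤ infDist c A := by
  let d := infDist x A
  let η := (R1 - d) / (R - d)
  have hRd : 0 < R - d := by simp only [d]; linarith
  have hη0 : 0 < η := div_pos (by simp only [d]; linarith) hRd
  have hη1 : η < 1 := by rw [div_lt_one hRd]; linarith
  have hcont : Continuous (fun y => infDist y A) := continuous_infDist_pt A
  obtain ⟨z, hzS, hz1, hz2⟩ := aux_ekeland (fun y => infDist y A) hcont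
    {y | infDist y A ≤ R1} (isClosed_le hcont continuous_const) R1 (fun y hy => hy) η hη0 x hx1.le
  simp only [mem_setOf_eq] at hzS hz2
  have hzpos : 0 < infDist z A := by
    have : 0 ≤ η * ‖z - x‖ := by positivity
    linarith
  refine ⟨z, ?_, ?_⟩
  · have : η * ‖z - x‖ ≤ η * (R - d) := by
      have : η * (R - d) = R1 - d := div_mul_cancel₀ _ hRd.ne'
      rw [this]; simp only [d]; linarith
    exact le_of_mul_le_mul_left this hη0
  · by_contra hlt
    push Not at hlt
    have hopen : IsOpen {x : X | 0 < infDist x A ∧ infDist x A < R} :=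
      (isOpen_lt continuous_const hcont).inter (isOpen_lt hcont continuous_const)
    have hdiff : DifferentiableAt ℝ (fun y => infDist y A) z :=
      (hA.2.differentiableOn (by norm_num)).differentiableAt
        (hopen.mem_nhds ⟨hzpos, by linarith⟩)
    obtain ⟨y, hyne, hyδ, hy⟩ := aux_ascent_s3 _ z hdiff (aux_grad A hne z hzpos hdiff) η hη0 hη1
      (R1 - infDist z A) (by linarith)
    refine hyne (hz2 y ?_ hy)
    have := infDist_le_infDist_add_dist (s := A) (x := y) (y := z)
    rw [dist_eq_norm] at this
    linarith

theorem statement3 (X : Type*) [NormedAddCommGroup X] [NormedSpace ℝ X]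
    [CompleteSpace X] [UniformConvexSpace X] (hsm : UnifSmooth X)
    (A : Set X) (R : ℝ) (hR : 0 < R) (hA : ProximallySmooth A R)
    (x0 x1 : X) (h0 : x0 ∈ A) (h1 : x1 ∈ A) (hd : ‖x0 - x1‖ / R < 2)
    (l : ℝ) (hl : l ∈ Set.Icc (0 : ℝ) 1) :
    Metric.infDist ((1 - l) • x0 + l • x1) A ≤
      8 * R * (l * (1 - l)) * modSmooth X (‖x0 - x1‖ / R) := by
  obtain ⟨hl0, hl1⟩ := hl
  have hl1' : 0 ≤ 1 - l := by linarith
  set x := (1 - l) • x0 + l • x1 with hx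
  set w := x0 - x1 with hw
  set τ := ‖w‖ / R with hτ
  have hwτ : ‖w‖ = R * τ := by rw [hτ]; field_simp
  have hτ0 : 0 ≤ τ := by positivity
  set μ := l * (1 - l) with hμ
  have hμ0 : 0 ≤ μ := mul_nonneg hl0 hl1'
  have hμ4 : μ ≤ 1 / 4 := by nlinarith [sq_nonneg (l - 1 / 2)]
  have hyτ : ‖(1 / R) • w‖ = τ := by
    rw [norm_smul, Real.norm_of_nonneg (by positivity), hτ]; ring
  have b0 : infDist x A ≤ l * (R * τ) := by
    refine (infDist_le_dist_of_mem h0).trans ?_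
    have : x - x0 = (-l) • w := by simp only [hx, hw]; module
    rw [dist_eq_norm, this, norm_smul, norm_neg, Real.norm_of_nonneg hl0, hwτ]
  have b1 : infDist x A ≤ (1 - l) * (R * τ) := by
    refine (infDist_le_dist_of_mem h1).trans ?_
    have : x - x1 = (1 - l) • w := by simp only [hx, hw]; module
    rw [dist_eq_norm, this, norm_smul, Real.norm_of_nonneg hl1', hwτ]
  have hRτ : 0 ≤ R * τ := by positivity
  -- convex combination of the two bounds
  have b2 : infDist x A ≤ 2 * μ * (R * τ) := by
    have c0 := mul_le_mul_of_nonneg_left b0 hl1'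
    have c1 := mul_le_mul_of_nonneg_left b1 hl0
    nlinarith
  rcases (infDist_nonneg (x := x) (s := A)).eq_or_lt with hz | hpos
  · -- distance zero
    rw [← hz]
    rcases hτ0.eq_or_lt with ht | ht
    · by_cases hX : ∃ u : X, ‖u‖ = 1
      · obtain ⟨u, hu⟩ := hX
        have := aux_rho u ((1 / R) • w) hu
        rw [hyτ] at this
        have hge : 0 ≤ modSmooth X τ := by
          have h3 := norm_add_le (u + (1 / R) • w) (u - (1 / R) • w)
          have h4 : (u + (1 / R) • w) + (u - (1 / R) • w) = (2 : ℝ) • u := by module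
          rw [h4, norm_smul, hu] at h3
          norm_num at h3
          norm_num at this
          linarith
        positivity
      · have : modSmooth X τ = 0 := by
          unfold modSmooth
          convert Real.sSup_empty
          rw [Set.eq_empty_iff_forall_notMem]
          rintro r ⟨a, b, ha, _⟩
          exact hX ⟨a, ha⟩
        rw [this]; simp
    · have hwpos : 0 < ‖w‖ := by rw [hwτ]; positivity
      have hu : ‖(1 / ‖w‖) • w‖ = 1 := by
        rw [norm_smul, Real.norm_of_nonneg (by positivity)]; field_simp
      have := aux_rho ((1 / ‖w‖) • w) ((1 / R) • w) hu
      rw [hyτ] at this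
      have hge : 0 ≤ modSmooth X τ := by
        have h3 := norm_add_le ((1 / ‖w‖) • w + (1 / R) • w) ((1 / ‖w‖) • w - (1 / R) • w)
        have h4 : ((1 / ‖w‖) • w + (1 / R) • w) + ((1 / ‖w‖) • w - (1 / R) • w)
          = (2 : ℝ) • ((1 / ‖w‖) • w) := by module
        rw [h4, norm_smul, hu, Real.norm_of_nonneg (by norm_num)] at h3
        linarith
      positivity
  have hτpos : 0 < τ := by
    rcases hτ0.eq_or_lt with ht | ht
    · rw [← ht] at b0; simp at b0; linarith
    · exact ht
  rcases le_or_gt τ (3 / 2) with hsmall | hbig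
  · -- main case
    have hdR : infDist x A < R := by nlinarith
    have key : ∀ R1, infDist x A < R1 → R1 < R →
        infDist x A / 4 ≤ 2 * R * μ * modSmooth X τ + (R - R1) * (7 / 4) := by
      intro R1 hR1 hR1'
      obtain ⟨c, hc1, hc2⟩ := aux_reach A ⟨x0, h0⟩ R hA x hpos R1 hR1 hR1'
      set v := c - x with hv
      set t := ‖v‖ with ht
      have htlow : R1 - infDist x A ≤ t := by
        have := infDist_le_infDist_add_dist (s := A) (x := c) (y := x)
        rw [dist_eq_norm] at this
        linarith
      have htpos : 0 < t := by linarith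
      let u := (1 / t) • v
      have hu : ‖u‖ = 1 := by
        simp only [u]
        rw [norm_smul, Real.norm_of_nonneg (by positivity), ← ht]; field_simp
      have hvu : v = t • u := by
        simp only [u]; rw [smul_smul, mul_one_div_cancel htpos.ne', one_smul]
      let y := (1 / R) • w
      have hwy : w = R • y := by
        simp only [y]; rw [smul_smul, mul_one_div_cancel hR.ne', one_smul]
      have hy : ‖y‖ = τ := hyτ
      have st := aux_stuff u y hu l hl0 hl1
      rw [hy] at st
      have hRt : 0 ≤ R - t := by linarith
      have e0 : R1 ≤ t * ‖u - l • y‖ + (R - t) * (l * τ) := by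
        refine (hc2.trans (infDist_le_dist_of_mem h0)).trans ?_
        have e : c - x0 = t • (u - l • y) - (R - t) • l • y := by
          have : c - x0 = v - l • w := by simp only [hv, hx, hw]; module
          rw [this, hvu, hwy]; module
        rw [dist_eq_norm, e]
        refine (norm_sub_le _ _).trans ?_
        rw [norm_smul, norm_smul, norm_smul, hy, Real.norm_of_nonneg htpos.le,
          Real.norm_of_nonneg hRt, Real.norm_of_nonneg hl0]
      have e1 : R1 ≤ t * ‖u + (1 - l) • y‖ + (R - t) * ((1 - l) * τ) := by
        refine (hc2.trans (infDist_le_dist_of_mem h1)).trans ?_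
        have e : c - x1 = t • (u + (1 - l) • y) + (R - t) • (1 - l) • y := by
          have : c - x1 = v + (1 - l) • w := by simp only [hv, hx, hw]; module
          rw [this, hvu, hwy]; module
        rw [dist_eq_norm, e]
        refine (norm_add_le _ _).trans ?_
        rw [norm_smul, norm_smul, norm_smul, hy, Real.norm_of_nonneg htpos.le,
          Real.norm_of_nonneg hRt, Real.norm_of_nonneg hl1']
      have hρ : 0 ≤ modSmooth X τ := by
        have h3 := norm_add_le (u + y) (u - y)
        have h4 : (u + y) + (u - y) = (2 : ℝ) • u := by module
        rw [h4, norm_smul, hu, Real.norm_of_nonneg (by norm_num)] at h3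
        have h5 := aux_rho u y hu
        rw [hy] at h5
        linarith
      have f0 := mul_le_mul_of_nonneg_left e0 hl1'
      have f1 := mul_le_mul_of_nonneg_left e1 hl0
      have f2 := mul_le_mul_of_nonneg_left st htpos.le
      have f3 : R1 ≤ t * (1 + 2 * μ * modSmooth X τ) + (R - t) * (2 * μ * τ) := by
        have : R1 = (1 - l) * R1 + l * R1 := by ring
        have e : (R - t) * (2 * μ * τ) =
          (1 - l) * ((R - t) * (l * τ)) + l * ((R - t) * ((1 - l) * τ)) := by
          simp only [hμ]; ring
        rw [e]
        linarith
      have f4 : 2 * μ * τ ≤ 3 / 4 := by nlinarith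
      have f5 := mul_le_mul_of_nonneg_left f4 hRt
      have f6 : t * (2 * μ * modSmooth X τ) ≤ R * (2 * μ * modSmooth X τ) :=
        mul_le_mul_of_nonneg_right (by linarith) (by positivity)
      linarith
    have : infDist x A / 4 ≤ 2 * R * μ * modSmooth X τ := by
      refine le_of_forall_pos_le_add fun ε hε => ?_
      let σ := min (ε / 2) ((R - infDist x A) / 2)
      have hσ : 0 < σ := lt_min (by linarith) (by linarith)
      have hσ1 : σ ≤ ε / 2 := min_le_left _ _
      have hσ2 : σ ≤ (R - infDist x A) / 2 := min_le_right _ _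
      have := key (R - σ) (by linarith) (by linarith)
      linarith
    linarith
  · have hwpos : 0 < ‖w‖ := by rw [hwτ]; positivity
    have hu : ‖(1 / ‖w‖) • w‖ = 1 := by
      rw [norm_smul, Real.norm_of_nonneg (by positivity)]; field_simp
    have h5 := aux_rho ((1 / ‖w‖) • w) ((1 / R) • w) hu
    rw [hyτ] at h5
    have e1 : ‖(1 / ‖w‖) • w + (1 / R) • w‖ = 1 + τ := by
      rw [← add_smul, norm_smul, Real.norm_of_nonneg (by positivity), add_mul, hτ]
      field_simp
    have e2 : τ - 1 ≤ ‖(1 / ‖w‖) • w - (1 / R) • w‖ := by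
      have := norm_sub_norm_le ((1 / R) • w) ((1 / ‖w‖) • w)
      rw [hyτ, hu, norm_sub_rev] at this
      exact this
    have h6 : τ ≤ 4 * modSmooth X τ := by linarith
    have h7 := mul_le_mul_of_nonneg_left h6 (show 0 ≤ 2 * μ * R by positivity)
    linarith
end
end

section
/- Let X be a uniformly convex and uniformly smooth real Banach space, let R > 0, and let A ⊂ X be proximally smooth with constant R. Let u ∈ X satisfy 0 < dist(u, A) < R, let y ∈ P_A(u), and let p be the unit functional attaining its norm on the vector u − y (i.e. ‖p‖ = 1 and ⟨p, u − y⟩ = ‖u − y‖). Then for every point a ∈ A one has ⟨p, a − y⟩ ≤ 2R·ρ_X(‖a − y‖/R). -/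
noncomputable section

open Set Metric

theorem ekel {X : Type*} [MetricSpace X] [CompleteSpace X] (f : X → ℝ) (hf : Continuous f)
    (M : ℝ) (hM : ∀ x, f x ≤ M) (c : ℝ) (hc : 0 < c) (u : X) :
    ∃ z, c * dist u z ≤ f z - f u ∧ ∀ w, c * dist z w ≤ f w - f z → w = z := by
  have step : ∀ (x : X) (n : ℕ), ∃ w, c * dist x w ≤ f w - f x ∧
      ∀ v, c * dist x v ≤ f v - f x → f v ≤ f w + 1 / ((n : ℝ) + 1) := by
    intro x n
    have hne : (f '' {w | c * dist x w ≤ f w - f x}).Nonempty := ⟨f x, x, by simp, rfl⟩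
    have hb : BddAbove (f '' {w | c * dist x w ≤ f w - f x}) := ⟨M, by
      rintro _ ⟨w, _, rfl⟩; exact hM w⟩
    have hpos : (0:ℝ) < 1 / ((n : ℝ) + 1) := by positivity
    obtain ⟨_, ⟨w, hw, rfl⟩, hlt⟩ := exists_lt_of_lt_csSup hne (sub_lt_self _ hpos)
    refine ⟨w, hw, fun v hv => ?_⟩
    have := le_csSup hb ⟨v, hv, rfl⟩
    linarith
  choose g hg1 hg2 using step
  let s : ℕ → X := fun n => Nat.rec u (fun n x => g x n) n
  have hs : ∀ n, s (n+1) = g (s n) n := fun n => rfl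
  have htr : ∀ n m, n ≤ m → c * dist (s n) (s m) ≤ f (s m) - f (s n) := by
    intro n m h
    induction m, h using Nat.le_induction with
    | base => simp
    | succ m h ih =>
      have h1 := hg1 (s m) m
      rw [← hs] at h1
      have h2 := mul_le_mul_of_nonneg_left (dist_triangle (s n) (s m) (s (m+1))) hc.le
      linarith
  have hmono : Monotone (fun n => f (s n)) := by
    intro n m h
    have := htr n m h
    have h0 : 0 ≤ c * dist (s n) (s m) := by positivity
    simp only
    linarith
  have hbd : BddAbove (range (fun n => f (s n))) := ⟨M, by rintro _ ⟨n, rfl⟩; exact hM _⟩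
  have hlim := tendsto_atTop_ciSup hmono hbd
  set L := ⨆ n, f (s n)
  have hcau : CauchySeq s := by
    refine cauchySeq_of_le_tendsto_0' (fun n => (L - f (s n)) / c) ?_ ?_
    · intro n m h
      rw [le_div_iff₀ hc]
      have := htr n m h
      have h3 : f (s m) ≤ L := le_ciSup hbd m
      linarith
    · have := (hlim.const_sub L).div_const c
      simpa using this
  obtain ⟨z, hz⟩ := cauchySeq_tendsto_of_complete hcau
  have hzs : ∀ n, c * dist (s n) z ≤ f z - f (s n) := by
    intro n
    have h1 : Filter.Tendsto (fun m => c * dist (s n) (s m)) Filter.atTop (nhds (c * dist (s n) z)) :=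
      (tendsto_const_nhds.dist hz).const_mul c
    have h2 : Filter.Tendsto (fun m => f (s m) - f (s n)) Filter.atTop (nhds (f z - f (s n))) :=
      ((hf.tendsto z).comp hz).sub_const _
    exact le_of_tendsto_of_tendsto h1 h2 (Filter.eventually_atTop.2 ⟨n, fun m h => htr n m h⟩)
  refine ⟨z, hzs 0, fun w hw => ?_⟩
  have key : ∀ n : ℕ, f w ≤ f z + 1 / ((n : ℝ) + 1) := by
    intro n
    have h2 := mul_le_mul_of_nonneg_left (dist_triangle (s n) z w) hc.le
    have h3 := hg2 (s n) n w (by linarith [hzs n])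
    rw [← hs] at h3
    have h4 := hzs (n+1)
    have h0 : 0 ≤ c * dist (s (n+1)) z := by positivity
    linarith
  have hle : f w ≤ f z := by
    have h1 := (tendsto_one_div_add_atTop_nhds_zero_nat (𝕜 := ℝ)).const_add (f z)
    have := ge_of_tendsto' h1 key
    simpa using this
  have h5 : dist z w ≤ 0 := by
    by_contra h
    push Not at h
    have : 0 < c * dist z w := by positivity
    linarith
  exact (dist_le_zero.1 h5).symm

theorem stepUp {X : Type*} [NormedAddCommGroup X] [NormedSpace ℝ X] (A : Set X) (R : ℝ) (x : X)
    (hd : DifferentiableAt ℝ (fun x => Metric.infDist x A) x)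
    (h0 : 0 < Metric.infDist x A) (hR : Metric.infDist x A < R) (ε : ℝ) (hε : 0 < ε) :
    ∃ w, w ≠ x ∧ Metric.infDist w A < R ∧
      (1 - ε) * dist x w ≤ Metric.infDist w A - Metric.infDist x A := by
  have hne : A.Nonempty := by
    rcases A.eq_empty_or_nonempty with h | h
    · simp [h] at h0
    · exact h
  obtain ⟨L, hL⟩ := hd
  have hη : 0 < ε / 3 := by positivity
  have hb := (hasFDerivAt_iff_isLittleO_nhds_zero.1 hL).def hη
  obtain ⟨δ, hδ, hball⟩ := Metric.eventually_nhds_iff.1 hb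
  set D := Metric.infDist x A
  obtain ⟨s, hs0, hs⟩ := exists_between (show 0 < min δ (min D (R - D)) from
    lt_min hδ (lt_min h0 (sub_pos.2 hR)))
  have hsδ : s < δ := hs.trans_le (min_le_left _ _)
  have hsD : s < D := hs.trans_le ((min_le_right _ _).trans (min_le_left _ _))
  have hsR : s < R - D := hs.trans_le ((min_le_right _ _).trans (min_le_right _ _))
  obtain ⟨a, ha, hxa⟩ := (Metric.infDist_lt_iff (x := x) (r := D + ε / 3 * s) hne).1
    (lt_add_of_pos_right _ (by positivity))
  have hDa : D ≤ dist x a := Metric.infDist_le_dist_of_mem ha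
  rw [dist_eq_norm] at hxa hDa
  have hn : 0 < ‖x - a‖ := h0.trans_le hDa
  set e := (s / ‖x - a‖) • (x - a) with he
  have hen : ‖e‖ = s := by
    rw [he, norm_smul, Real.norm_of_nonneg (by positivity)]
    field_simp
  have h1 := hball (y := e) (by simpa [hen] using hsδ)
  have h2 := hball (y := -e) (by simpa [hen] using hsδ)
  rw [norm_neg, hen, Real.norm_eq_abs, map_neg] at h2
  rw [hen, Real.norm_eq_abs] at h1
  have h1' := (abs_le.1 h1).1
  have h2' := (abs_le.1 h2).1
  have h3 : Metric.infDist (x + -e) A ≤ ‖x - a‖ - s := by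
    refine (Metric.infDist_le_dist_of_mem ha).trans ?_
    rw [dist_eq_norm]
    have : x + -e - a = (1 - s / ‖x - a‖) • (x - a) := by
      rw [he, sub_smul, one_smul]; abel
    rw [this, norm_smul, Real.norm_of_nonneg]
    · apply le_of_eq; field_simp
    · rw [sub_nonneg, div_le_one hn]; linarith
  have hdist : dist x (x + e) = s := by simp [hen]
  refine ⟨x + e, ?_, ?_, ?_⟩
  · intro h
    rw [h, dist_self] at hdist
    linarith
  · have := Metric.infDist_le_infDist_add_dist (x := x + e) (y := x) (s := A)
    rw [dist_comm, hdist] at this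
    linarith
  · rw [hdist]
    nlinarith

theorem climb {X : Type*} [NormedAddCommGroup X] [NormedSpace ℝ X] [CompleteSpace X]
    (A : Set X) (R : ℝ) (hA : ProximallySmooth A R)
    (u : X) (hu0 : 0 < Metric.infDist u A) (huR : Metric.infDist u A < R)
    (ε : ℝ) (hε : 0 < ε) (hε1 : ε < 1) :
    ∃ z, R ≤ Metric.infDist z A ∧ (1 - ε) * ‖z - u‖ ≤ R - Metric.infDist u A := by
  obtain ⟨z, hz1, hz2⟩ := ekel (fun x => min (Metric.infDist x A) R)
    ((Metric.continuous_infDist_pt A).min continuous_const) R (fun x => min_le_right _ _)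
    (1 - ε) (sub_pos.2 hε1) u
  simp only [min_eq_left huR.le] at hz1
  have hzd : 0 ≤ (1 - ε) * dist u z := mul_nonneg (sub_pos.2 hε1).le dist_nonneg
  refine ⟨z, ?_, ?_⟩
  · by_contra hlt
    push Not at hlt
    have hpos : 0 < Metric.infDist z A := by
      have := min_le_left (Metric.infDist z A) R
      linarith
    have hopen : IsOpen {x : X | 0 < Metric.infDist x A ∧ Metric.infDist x A < R} :=
      (isOpen_lt continuous_const (Metric.continuous_infDist_pt A)).inter
        (isOpen_lt (Metric.continuous_infDist_pt A) continuous_const)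
    have hd : DifferentiableAt ℝ (fun x => Metric.infDist x A) z :=
      (hA.2.differentiableOn (by norm_num)).differentiableAt (hopen.mem_nhds ⟨hpos, hlt⟩)
    obtain ⟨w, hw, hwR, hwd⟩ := stepUp A R z hd hpos hlt ε hε
    exact hw (hz2 w (by simpa only [min_eq_left hwR.le, min_eq_left hlt.le] using hwd))
  · rw [dist_comm, dist_eq_norm] at hz1
    have := min_le_right (Metric.infDist z A) R
    linarith

theorem far {X : Type*} [NormedAddCommGroup X] [NormedSpace ℝ X]
    [CompleteSpace X] [UniformConvexSpace X]
    (A : Set X) (R : ℝ) (hA : ProximallySmooth A R)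
    (u : X) (hu0 : 0 < Metric.infDist u A) (huR : Metric.infDist u A < R)
    (y : X) (hy : y ∈ metricProj A u) :
    R ≤ Metric.infDist (y + (R / ‖u - y‖) • (u - y)) A := by
  apply le_of_forall_pos_le_add
  intro η hη
  have hyA := hy.1
  have hyD : ‖u - y‖ = Metric.infDist u A := by rw [norm_sub_rev]; exact hy.2
  rw [← hyD] at hu0 huR
  set D := ‖u - y‖ with hD
  set L := R - D with hL
  have hL0 : 0 < L := sub_pos.2 huR
  obtain ⟨δ, hδ, huc⟩ := exists_forall_sphere_dist_add_le_two_sub X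
    (show 0 < η / (2 * L) by positivity)
  obtain ⟨ε, hε0, hε⟩ := exists_between (show 0 < min (1/2) (min (η / (4 * L)) (δ / (2 * L / D + 1)))
    from lt_min (by norm_num) (lt_min (by positivity) (by positivity)))
  have he1 : ε < 1 / 2 := hε.trans_le (min_le_left _ _)
  have he2 : ε < η / (4 * L) := hε.trans_le ((min_le_right _ _).trans (min_le_left _ _))
  have he3 : ε < δ / (2 * L / D + 1) := hε.trans_le ((min_le_right _ _).trans (min_le_right _ _))
  rw [lt_div_iff₀ (by positivity)] at he2 he3
  obtain ⟨z, hzR, hzu⟩ := climb A R hA u (hyD ▸ hu0) (hyD ▸ huR) ε hε0 (by linarith)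
  rw [← hyD] at hzu
  set w := z - u with hw
  have hzy : R ≤ ‖w + (u - y)‖ := by
    have := hzR.trans (Metric.infDist_le_dist_of_mem hyA)
    rwa [dist_eq_norm, show z - y = w + (u - y) by rw [hw]; abel] at this
  have hwL : L ≤ ‖w‖ := by
    have := norm_add_le w (u - y)
    linarith
  have hw0 : 0 < ‖w‖ := hL0.trans_le hwL
  have hw2 : ‖w‖ ≤ L + 2 * ε * L := by
    have : ‖w‖ ≤ 2 * L := by nlinarith
    nlinarith
  set x := D⁻¹ • (u - y) with hx
  set x' := ‖w‖⁻¹ • w with hx'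
  have hxn : ‖x‖ = 1 := by
    rw [hx, norm_smul, Real.norm_of_nonneg (by positivity), ← hD]; field_simp
  have hxn' : ‖x'‖ = 1 := by
    rw [hx', norm_smul, Real.norm_of_nonneg (by positivity)]; field_simp
  have hclose : ‖x - x'‖ < η / (2 * L) := by
    by_contra hcon
    push Not at hcon
    have h1 := huc hxn hxn' hcon
    obtain ⟨q, hq1, hq2⟩ := exists_dual_vector'' ℝ (w + (u - y))
    have hqle : ∀ v, q v ≤ ‖v‖ := fun v => (le_abs_self _).trans (by
      have := q.le_of_opNorm_le hq1 v
      simpa using this)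
    have hq3 : R ≤ q w + q (u - y) := by
      rw [← map_add, hq2]; simpa using hzy
    have hqx : 1 - 2 * ε * L / D ≤ q x := by
      rw [hx, map_smul, smul_eq_mul]
      have : D - 2 * ε * L ≤ q (u - y) := by linarith [hqle w]
      calc 1 - 2 * ε * L / D = D⁻¹ * (D - 2 * ε * L) := by field_simp
        _ ≤ _ := by gcongr
    have hqx' : 1 - ε ≤ q x' := by
      rw [hx', map_smul, smul_eq_mul]
      have : L ≤ q w := by linarith [hqle (u - y)]
      calc 1 - ε = ‖w‖⁻¹ * ((1 - ε) * ‖w‖) := by field_simp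
        _ ≤ _ := by gcongr; linarith
    have h2 := hqle (x + x')
    rw [map_add] at h2
    have h3 : ε * (2 * L / D + 1) = 2 * ε * L / D + ε := by ring
    linarith
  have hz : dist z (y + (R / D) • (u - y)) ≤ η := by
    have e1 : (u - y) = D • x := by rw [hx, smul_smul, mul_inv_cancel₀ hu0.ne', one_smul]
    have e2 : w = ‖w‖ • x' := by rw [hx', smul_smul, mul_inv_cancel₀ hw0.ne', one_smul]
    clear_value x x'
    have e3 : z - (y + (R / D) • (u - y)) = (‖w‖ - L) • x' + L • (x' - x) := by
      calc z - (y + (R / D) • (u - y)) = w + (u - y) - (R / D) • (u - y) := by rw [hw]; abel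
        _ = ‖w‖ • x' + D • x - (R / D) • (D • x) := by rw [← e1, ← e2]
        _ = _ := by
          rw [smul_smul, div_mul_cancel₀ _ hu0.ne', sub_smul, smul_sub, hL, sub_smul, sub_smul]; abel
    rw [dist_eq_norm, e3]
    refine (norm_add_le _ _).trans ?_
    rw [norm_smul, norm_smul, Real.norm_of_nonneg (by linarith), Real.norm_of_nonneg hL0.le, hxn',
      norm_sub_rev x' x]
    rw [lt_div_iff₀ (by positivity)] at hclose
    nlinarith
  have := Metric.infDist_le_infDist_add_dist (x := z) (y := y + (R / D) • (u - y)) (s := A)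
  linarith

theorem statement4 (X : Type*) [NormedAddCommGroup X] [NormedSpace ℝ X]
    [CompleteSpace X] [UniformConvexSpace X] (hsm : UnifSmooth X)
    (A : Set X) (R : ℝ) (hR : 0 < R) (hA : ProximallySmooth A R)
    (u : X) (hu0 : 0 < Metric.infDist u A) (huR : Metric.infDist u A < R)
    (y : X) (hy : y ∈ metricProj A u)
    (p : X →L[ℝ] ℝ) (hp : ‖p‖ = 1) (hpu : p (u - y) = ‖u - y‖) :
    ∀ a ∈ A, p (a - y) ≤ 2 * R * modSmooth X (‖a - y‖ / R) := by
  intro a ha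
  have hyD : ‖u - y‖ = Metric.infDist u A := by rw [norm_sub_rev]; exact hy.2
  have hfar := far A R hA u hu0 huR y hy
  rw [← hyD] at hu0
  set e := ‖u - y‖⁻¹ • (u - y) with he
  have hen : ‖e‖ = 1 := by
    rw [he, norm_smul, Real.norm_of_nonneg (by positivity)]; field_simp
  have hpe : p e = 1 := by
    rw [he, map_smul, hpu, smul_eq_mul]; field_simp
  have hRe : (R / ‖u - y‖) • (u - y) = R • e := by rw [he, smul_smul]; rfl
  rw [hRe] at hfar
  have h1 : R ≤ ‖R • e - (a - y)‖ := by
    have := hfar.trans (Metric.infDist_le_dist_of_mem ha)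
    rwa [dist_eq_norm, show y + R • e - a = R • e - (a - y) by abel] at this
  have h2 : R + p (a - y) ≤ ‖R • e + (a - y)‖ := by
    have := (le_abs_self _).trans (p.le_opNorm (R • e + (a - y)))
    rw [hp, one_mul, map_add, map_smul, hpe, smul_eq_mul, mul_one] at this
    exact this
  have hb : BddAbove {r : ℝ | ∃ x z : X, ‖x‖ = 1 ∧ ‖z‖ = ‖a - y‖ / R ∧
      r = (‖x + z‖ + ‖x - z‖) / 2 - 1} := by
    refine ⟨‖a - y‖ / R, ?_⟩
    rintro _ ⟨x, z, hx, hz, rfl⟩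
    have := norm_add_le x z
    have := norm_sub_le x z
    linarith
  have h3 : (‖e + R⁻¹ • (a - y)‖ + ‖e - R⁻¹ • (a - y)‖) / 2 - 1 ≤ modSmooth X (‖a - y‖ / R) := by
    refine le_csSup hb ⟨e, R⁻¹ • (a - y), hen, ?_, rfl⟩
    rw [norm_smul, Real.norm_of_nonneg (by positivity)]; field_simp
  clear_value e
  have e1 : ‖R • e + (a - y)‖ = R * ‖e + R⁻¹ • (a - y)‖ := by
    rw [← norm_smul_of_nonneg hR.le, smul_add, smul_smul, mul_inv_cancel₀ hR.ne', one_smul]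
  have e2 : ‖R • e - (a - y)‖ = R * ‖e - R⁻¹ • (a - y)‖ := by
    rw [← norm_smul_of_nonneg hR.le, smul_sub, smul_smul, mul_inv_cancel₀ hR.ne', one_smul]
  have h4 := mul_le_mul_of_nonneg_left h3 hR.le
  rw [e1] at h2
  rw [e2] at h1
  nlinarith
end
end

section
/- Let X be a uniformly convex and uniformly smooth real Banach space and let A ⊂ X be proximally smooth with constant R > 0. Then for any distinct x0, x1 ∈ A with ‖x0 − x1‖/R < 2, there exists a slice-projection of the midpoint of the segment [x0, x1] onto A; that is, there exists a point z ∈ P_A([x0, x1]) such that z − (x0 + x1)/2 is quasi-orthogonal to x0 − x1. -/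
noncomputable section

open Set Metric

lemma aux_deriv {X : Type*} [NormedAddCommGroup X] [NormedSpace ℝ X]
    (A : Set X) (x : X) (L : X →L[ℝ] ℝ)
    (hL : HasFDerivAt (fun x => Metric.infDist x A) L x) (η : ℝ) (hη : 0 < η) :
    ∃ δ > 0, ∀ a ∈ A, ‖x - a‖ < infDist x A + δ → infDist x A - η < L (x - a) := by
  have hd0 : 0 ≤ infDist x A := infDist_nonneg
  set d := infDist x A with hd
  have hc : 0 < η / (4 * (d + 1)) := by positivity
  have h1 := (hasFDerivAt_iff_isLittleO_nhds_zero.1 hL).def hc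
  obtain ⟨r, hr, h2⟩ := Metric.eventually_nhds_iff.1 h1
  obtain ⟨t, ht0, ht1, htr⟩ : ∃ t : ℝ, 0 < t ∧ t ≤ 1 ∧ t * (d + 1) < r := by
    refine ⟨min 1 (r / (2 * (d + 1))), by positivity, min_le_left _ _, ?_⟩
    have : min 1 (r / (2 * (d + 1))) ≤ r / (2 * (d + 1)) := min_le_right _ _
    calc _ ≤ r / (2 * (d + 1)) * (d + 1) := by gcongr
      _ = r / 2 := by field_simp
      _ < r := by linarith
  refine ⟨min 1 (t * η / 4), by positivity, fun a ha hxa => ?_⟩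
  have e1 : ‖x - a‖ < d + 1 := lt_of_lt_of_le hxa (by gcongr; exact min_le_left _ _)
  have e2 : ‖x - a‖ < d + t * η / 4 := lt_of_lt_of_le hxa (by gcongr; exact min_le_right _ _)
  have hn : ‖t • (a - x)‖ = t * ‖x - a‖ := by
    rw [norm_smul, Real.norm_of_nonneg ht0.le, norm_sub_rev]
  have h3 := h2 (y := t • (a - x)) (by
    rw [dist_zero_right, hn]
    exact lt_of_le_of_lt (by gcongr) htr)
  rw [hn] at h3
  have h4 : infDist (x + t • (a - x)) A ≤ (1 - t) * ‖x - a‖ := by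
    refine (infDist_le_dist_of_mem ha).trans ?_
    rw [dist_eq_norm, show x + t • (a - x) - a = (1 - t) • (x - a) by module, norm_smul,
      Real.norm_of_nonneg (by linarith)]
  have h5 := (abs_le.1 (by simpa only [Real.norm_eq_abs] using h3)).1
  have h6 : L (t • (a - x)) = - (t * L (x - a)) := by
    simp only [map_smul, map_sub, smul_eq_mul]; ring
  rw [h6] at h5
  have h7 : η / (4 * (d + 1)) * (t * ‖x - a‖) ≤ t * η / 4 := by
    calc _ ≤ η / (4 * (d + 1)) * (t * (d + 1)) := by gcongr
      _ = _ := by field_simp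
  have h8 : (1 - t) * ‖x - a‖ ≤ (1 - t) * (d + t * η / 4) := by
    apply mul_le_mul_of_nonneg_left e2.le; linarith
  have h9 : 0 < t * (t * η) := by positivity
  have h11 : 0 < t * η := by positivity
  have h10 : t * (d - η) < t * L (x - a) := by
    rw [← hd] at h5
    nlinarith
  exact lt_of_mul_lt_mul_left h10 ht0.le

lemma aux_wp {X : Type*} [NormedAddCommGroup X] [NormedSpace ℝ X] [UniformConvexSpace X]
    (A : Set X) (x : X)
    (hD : 0 < infDist x A → DifferentiableAt ℝ (fun x => Metric.infDist x A) x)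
    (ε : ℝ) (hε : 0 < ε) :
    ∃ δ > 0, ∀ a ∈ A, ∀ b ∈ A, ‖x - a‖ < infDist x A + δ → ‖x - b‖ < infDist x A + δ →
      ‖a - b‖ < ε := by
  rcases (infDist_nonneg (x := x) (s := A)).eq_or_lt with h | h
  · refine ⟨ε / 2, by positivity, fun a _ b _ h1 h2 => ?_⟩
    rw [← h] at h1 h2
    have := norm_sub_le (x - b) (x - a)
    rw [show (x - b) - (x - a) = a - b by abel] at this
    linarith
  · have hL := (hD h).hasFDerivAt
    set L := fderiv ℝ (fun x => Metric.infDist x A) x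
    have hLn : ‖L‖ ≤ 1 := by
      simpa using hL.le_of_lipschitz (C := 1) (lipschitz_infDist_pt A)
    obtain ⟨κ, hκ, hU⟩ := exists_forall_closed_ball_dist_add_le_two_mul_sub X
      (half_pos hε) (infDist x A)
    obtain ⟨δ, hδ, h1⟩ := aux_deriv A x L hL (κ / 4) (by positivity)
    set d := infDist x A
    have key : ∀ a ∈ A, ‖x - a‖ < d + min δ (min (ε / 4) (κ / 8)) →
        ∃ v, ‖v‖ ≤ d ∧ ‖(x - a) - v‖ < ε / 4 ∧ d - κ / 4 - κ / 8 < L v := by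
      intro a ha hxa
      have e1 : ‖x - a‖ < d + δ := lt_of_lt_of_le hxa (by gcongr; exact min_le_left _ _)
      have e2 : ‖x - a‖ < d + ε / 4 := lt_of_lt_of_le hxa
        (by gcongr; exact (min_le_right _ _).trans (min_le_left _ _))
      have e3 : ‖x - a‖ < d + κ / 8 := lt_of_lt_of_le hxa
        (by gcongr; exact (min_le_right _ _).trans (min_le_right _ _))
      have e4 : d ≤ ‖x - a‖ := by
        rw [← dist_eq_norm]; exact infDist_le_dist_of_mem ha
      have e5 : 0 < ‖x - a‖ := h.trans_le e4
      have e6 : ‖(x - a) - (d / ‖x - a‖) • (x - a)‖ = ‖x - a‖ - d := by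
        rw [show (x - a) - (d / ‖x - a‖) • (x - a) = (1 - d / ‖x - a‖) • (x - a) by module,
          norm_smul, Real.norm_of_nonneg (by rw [sub_nonneg]; exact div_le_one_of_le₀ e4 e5.le)]
        field_simp
      refine ⟨(d / ‖x - a‖) • (x - a), ?_, by linarith, ?_⟩
      · rw [norm_smul, Real.norm_of_nonneg (by positivity)]
        exact (by field_simp : _ = d).le
      · have h2 := h1 a ha e1
        have h3 : L ((x - a) - (d / ‖x - a‖) • (x - a)) ≤ ‖x - a‖ - d := by
          rw [← e6]
          refine (le_abs_self _).trans ((L.le_opNorm _).trans ?_)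
          exact mul_le_of_le_one_left (norm_nonneg _) hLn
        rw [map_sub] at h3
        linarith
    refine ⟨min δ (min (ε / 4) (κ / 8)), by positivity, fun a ha b hb hxa hxb => ?_⟩
    obtain ⟨v, v1, v2, v3⟩ := key a ha hxa
    obtain ⟨w, w1, w2, w3⟩ := key b hb hxb
    by_contra! hcon
    have h4 : ε / 2 ≤ ‖v - w‖ := by
      have t1 : a - b = ((x - b) - w) - ((x - a) - v) - (v - w) := by abel
      have t2 := norm_sub_le (((x - b) - w) - ((x - a) - v)) (v - w)
      have t3 := norm_sub_le ((x - b) - w) ((x - a) - v)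
      rw [← t1] at t2
      linarith
    have h5 := hU v1 w1 h4
    have h6 : L (v + w) ≤ ‖v + w‖ :=
      (le_abs_self _).trans ((L.le_opNorm _).trans (mul_le_of_le_one_left (norm_nonneg _) hLn))
    rw [map_add] at h6
    linarith

lemma aux_ex {X : Type*} [NormedAddCommGroup X] [NormedSpace ℝ X] [UniformConvexSpace X]
    [CompleteSpace X] (A : Set X) (hA : IsClosed A) (hne : A.Nonempty) (x : X)
    (hD : 0 < infDist x A → DifferentiableAt ℝ (fun x => Metric.infDist x A) x) :
    ∃ a ∈ A, ‖a - x‖ = infDist x A := by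
  have hex : ∀ n : ℕ, ∃ a ∈ A, ‖x - a‖ < infDist x A + 1 / ((n : ℝ) + 1) := by
    intro n
    obtain ⟨a, ha, h⟩ := (infDist_lt_iff (x := x) (r := infDist x A + 1 / ((n : ℝ) + 1)) hne).1
      (by have : 0 < 1 / ((n : ℝ) + 1) := by positivity
          linarith)
    exact ⟨a, ha, by rwa [← dist_eq_norm]⟩
  choose a ha hxa using hex
  have hlim := tendsto_one_div_add_atTop_nhds_zero_nat (𝕜 := ℝ)
  have hc : CauchySeq a := by
    refine Metric.cauchySeq_iff.2 fun ε hε => ?_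
    obtain ⟨δ, hδ, h⟩ := aux_wp A x hD ε hε
    obtain ⟨N, hN⟩ := Filter.eventually_atTop.1 (hlim.eventually_lt_const hδ)
    refine ⟨N, fun m hm n hn => ?_⟩
    rw [dist_eq_norm]
    exact h _ (ha m) _ (ha n) ((hxa m).trans (by linarith [hN m hm]))
      ((hxa n).trans (by linarith [hN n hn]))
  obtain ⟨b, hb⟩ := cauchySeq_tendsto_of_complete hc
  have hbA : b ∈ A := hA.mem_of_tendsto hb (Filter.Eventually.of_forall ha)
  refine ⟨b, hbA, le_antisymm ?_ ?_⟩
  · have h1 : Filter.Tendsto (fun n => ‖x - a n‖) Filter.atTop (nhds ‖x - b‖) :=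
      (tendsto_const_nhds.sub hb).norm
    have h2 := (tendsto_const_nhds (x := infDist x A)).add hlim
    rw [add_zero] at h2
    rw [norm_sub_rev]
    exact le_of_tendsto_of_tendsto' h1 h2 fun n => (hxa n).le
  · rw [norm_sub_rev, ← dist_eq_norm]; exact infDist_le_dist_of_mem hbA

theorem statement5 (X : Type*) [NormedAddCommGroup X] [NormedSpace ℝ X]
    [CompleteSpace X] [UniformConvexSpace X] (hsm : UnifSmooth X)
    (A : Set X) (R : ℝ) (hR : 0 < R) (hA : ProximallySmooth A R)
    (x0 x1 : X) (h0 : x0 ∈ A) (h1 : x1 ∈ A) (hne : x0 ≠ x1)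
    (hd : ‖x0 - x1‖ / R < 2) :
    ∃ z : X, IsSliceProj A x0 x1 z := by
  obtain ⟨hcl, hC⟩ := hA
  rw [div_lt_iff₀ hR] at hd
  have hopen : IsOpen {x : X | 0 < infDist x A ∧ infDist x A < R} :=
    (isOpen_lt continuous_const (continuous_infDist_pt A)).inter
      (isOpen_lt (continuous_infDist_pt A) continuous_const)
  let s : ℝ → X := fun t => x0 + t • (x1 - x0)
  have hs : Continuous s := by fun_prop
  have hdiff : ∀ t ∈ Icc (0:ℝ) 1, 0 < infDist (s t) A →
      DifferentiableAt ℝ (fun x => Metric.infDist x A) (s t) := by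
    intro t ht hpos
    have hlt : infDist (s t) A < R := by
      have i0 : infDist (s t) A ≤ t * ‖x0 - x1‖ := by
        refine (infDist_le_dist_of_mem h0).trans ?_
        rw [dist_eq_norm, show s t - x0 = (-t) • (x0 - x1) by simp only [s]; module, norm_smul,
          norm_neg, Real.norm_of_nonneg ht.1]
      have i1 : infDist (s t) A ≤ (1 - t) * ‖x0 - x1‖ := by
        refine (infDist_le_dist_of_mem h1).trans ?_
        rw [dist_eq_norm, show s t - x1 = (1 - t) • (x0 - x1) by simp only [s]; module, norm_smul,
          Real.norm_of_nonneg (by linarith [ht.2])]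
      linarith
    exact (hC.differentiableOn (by norm_num)).differentiableAt (hopen.mem_nhds ⟨hpos, hlt⟩)
  have hex : ∀ t ∈ Icc (0:ℝ) 1, ∃ a, a ∈ A ∧ ‖a - s t‖ = infDist (s t) A := by
    intro t ht
    exact aux_ex A hcl ⟨x0, h0⟩ (s t) (hdiff t ht)
  choose! p hpA hp using hex
  have hcont : ContinuousOn p (Icc 0 1) := by
    intro t ht
    rw [ContinuousWithinAt, Metric.tendsto_nhds]
    intro ε hε
    obtain ⟨δ, hδ, h⟩ := aux_wp A (s t) (hdiff t ht) ε hε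
    have hF : Continuous fun u => ‖s t - s u‖ + infDist (s u) A :=
      (continuous_const.sub hs).norm.add ((continuous_infDist_pt A).comp hs)
    have hev : ∀ᶠ u in nhdsWithin t (Icc 0 1),
        ‖s t - s u‖ + infDist (s u) A < infDist (s t) A + δ :=
      (hF.continuousWithinAt (s := Icc 0 1) (x := t)).eventually_lt_const (by simpa using hδ)
    filter_upwards [hev, self_mem_nhdsWithin] with u hu hum
    rw [dist_eq_norm]
    refine h _ (hpA u hum) _ (hpA t ht) ?_ ?_
    · have := norm_sub_le_norm_sub_add_norm_sub (s t) (s u) (p u)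
      rw [norm_sub_rev (s u), hp u hum] at this
      linarith
    · rw [norm_sub_rev, hp t ht]; linarith
  obtain ⟨φ, hφ1, hφ⟩ := exists_dual_vector ℝ (x0 - x1) (norm_ne_zero_iff.2 (sub_ne_zero.2 hne))
  have hφ' : φ (x0 - x1) = ‖x0 - x1‖ := by simpa using hφ
  have hpos : 0 < ‖x0 - x1‖ := norm_pos_iff.2 (sub_ne_zero.2 hne)
  have hfix : ∀ t ∈ Icc (0:ℝ) 1, s t ∈ A → p t = s t := by
    intro t ht hm
    have := hp t ht
    rw [infDist_zero_of_mem hm, norm_eq_zero, sub_eq_zero] at this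
    exact this
  have hp0 : p 0 = x0 := by
    have e : s 0 = x0 := by simp [s]
    rw [hfix 0 (by simp) (e ▸ h0), e]
  have hp1 : p 1 = x1 := by
    have e : s 1 = x1 := by simp [s]
    rw [hfix 1 (by simp) (e ▸ h1), e]
  have hg : ContinuousOn (fun t => φ (p t - midpoint ℝ x0 x1)) (Icc 0 1) :=
    φ.continuous.comp_continuousOn (hcont.sub continuousOn_const)
  have hm0 : x0 - midpoint ℝ x0 x1 = (1 / 2 : ℝ) • (x0 - x1) := by
    rw [midpoint_eq_smul_add, invOf_eq_inv]; module
  have hm1 : x1 - midpoint ℝ x0 x1 = (-(1 / 2) : ℝ) • (x0 - x1) := by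
    rw [midpoint_eq_smul_add, invOf_eq_inv]; module
  have hmem : (0 : ℝ) ∈ Icc (φ (p 1 - midpoint ℝ x0 x1)) (φ (p 0 - midpoint ℝ x0 x1)) := by
    rw [hp0, hp1, hm0, hm1, map_smul, map_smul, hφ', smul_eq_mul, smul_eq_mul]
    constructor <;> linarith
  obtain ⟨t, ht, hz⟩ := intermediate_value_Icc' zero_le_one hg hmem
  refine ⟨p t, ?_, ?_⟩
  · refine mem_iUnion₂.2 ⟨s t, ?_, hpA t ht, hp t ht⟩
    rw [segment_eq_image']
    exact ⟨t, ht, rfl⟩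
  · intro l
    have e : φ (x0 - x1 + l • (p t - midpoint ℝ x0 x1)) = ‖x0 - x1‖ := by
      rw [map_add, map_smul, hφ']
      simp only at hz
      rw [hz]; simp
    rw [← e]
    refine (le_abs_self _).trans ((φ.le_opNorm _).trans ?_)
    rw [hφ1, one_mul]
end
end
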